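/- arXiv:2405.01706 — 2 statements merged into one kernel-verified Lean document; each statement's English description precedes it below -/
import Mathlib

section
/- Let X be a smooth plane dendroid with initial point p. Then every endpoint e ∈ E(X) \ {p} is accessible from ℝ² \ X. -/
open Set Filter Topology

/-- The Euclidean plane. -/
abbrev Plane := EuclideanSpace ℝ (Fin 2)

section Defs

variable {α : Type*} [TopologicalSpace α]

/-- `A` is an arc with endpoints `a` and `b`: a homeomorphic image of `[0,1]`
sending `0 ↦ a` and `1 ↦ b`. -/
def IsArcWithEndpoints (A : Set α) (a b : α) : Prop :=
  ∃ f : ℝ → α, ContinuousOn f (Set.Icc 0 1) ∧ Set.InjOn f (Set.Icc 0 1) ∧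
    f '' (Set.Icc 0 1) = A ∧ f 0 = a ∧ f 1 = b

/-- `A` is an arc. -/
def IsArc (A : Set α) : Prop := ∃ a b, IsArcWithEndpoints A a b

/-- Every two distinct points of `X` are joined by an arc inside `X`. -/
def ArcwiseConnected (X : Set α) : Prop :=
  ∀ x ∈ X, ∀ y ∈ X, x ≠ y → ∃ A, A ⊆ X ∧ IsArcWithEndpoints A x y

/-- Every two subcontinua of `X` have connected intersection. -/
def HereditarilyUnicoherent (X : Set α) : Prop :=
  ∀ K L : Set α, K ⊆ X → L ⊆ X → IsCompact K → IsConnected K →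
    IsCompact L → IsConnected L → IsPreconnected (K ∩ L)

/-- A dendroid: a hereditarily unicoherent, arcwise connected continuum. -/
def IsDendroid (X : Set α) : Prop :=
  IsCompact X ∧ IsConnected X ∧ HereditarilyUnicoherent X ∧ ArcwiseConnected X

/-- The set of endpoints of `X`: points that are endpoints of every arc in `X`
containing them. -/
def Endpoints (X : Set α) : Set α :=
  {e | e ∈ X ∧ ∀ A : Set α, A ⊆ X → IsArc A → e ∈ A → ∃ b, IsArcWithEndpoints A e b}

/-- `X` is Suslinian: every collection of pairwise-disjoint non-degenerate
subcontinua of `X` is countable. -/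
def IsSuslinian (X : Set α) : Prop :=
  ∀ S : Set (Set α), (∀ K ∈ S, K ⊆ X ∧ IsCompact K ∧ IsConnected K ∧ K.Nontrivial) →
    S.PairwiseDisjoint id → S.Countable

/-- The arc component of `x` inside the set `S`. -/
def arcComponentIn (S : Set α) (x : α) : Set α :=
  {y | y ∈ S ∧ (y = x ∨ ∃ A, A ⊆ S ∧ IsArcWithEndpoints A x y)}

/-- The collection of arc components of `X \ {x}`; its cardinality is the order of `x`. -/
def orderComponents (X : Set α) (x : α) : Set (Set α) :=
  {C | ∃ y ∈ X \ {x}, C = arcComponentIn (X \ {x}) y}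

/-- Ramification points of `X`: points of order at least 3. -/
def RamificationPoints (X : Set α) : Set α :=
  {x | x ∈ X ∧ 3 ≤ (orderComponents X x).encard}

/-- `A` is a clopen subset of the subspace `Y`. -/
def IsClopenIn (Y A : Set α) : Prop :=
  A ⊆ Y ∧ (∃ U, IsOpen U ∧ A = Y ∩ U) ∧ (∃ C, IsClosed C ∧ A = Y ∩ C)

/-- The quasicomponent of `x` in the subspace `Y`: the intersection of all
clopen subsets of `Y` containing `x`. -/
def quasicomponentIn (Y : Set α) (x : α) : Set α :=
  {y ∈ Y | ∀ A : Set α, IsClopenIn Y A → x ∈ A → y ∈ A}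

/-- `Y` is hereditarily disconnected: it contains no non-degenerate connected subset. -/
def HereditarilyDisconnected (Y : Set α) : Prop :=
  ∀ S : Set α, S ⊆ Y → IsPreconnected S → S.Subsingleton

end Defs

/-- The point `x` of `X` is (arcwise) accessible from `ℝ² \ X`. -/
def AccessiblePoint (X : Set Plane) (x : Plane) : Prop :=
  ∃ A : Set Plane, IsArc A ∧ A ∩ X = {x}

/-- `σ` separates the points `b` and `d` in the plane: no connected subset of the
complement of `σ` contains both. -/
def SeparatesPoints (σ : Set Plane) (b d : Plane) : Prop :=
  b ∉ σ ∧ d ∉ σ ∧ ∀ K : Set Plane, K ⊆ σᶜ → IsPreconnected K → b ∈ K → d ∉ K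

/-- A simple closed curve in the plane: the image of a period-1 parametrization
injective on `[0,1)`. -/
def IsSimpleClosedCurve (O : Set Plane) : Prop :=
  ∃ f : ℝ → Plane, Continuous f ∧ Function.Periodic f 1 ∧
    Set.InjOn f (Set.Ico 0 1) ∧ f '' (Set.Ico 0 1) = O

/-- The dendroid `X` is smooth at `p`: there is a choice `arcTo x` of the unique arc
from `x` to `p` (reduced to `{p}` for `x = p`) such that `xₙ → x` in `X` implies
`arcTo xₙ → arcTo x` in the Hausdorff distance. -/
def DendroidSmoothAt (X : Set Plane) (p : Plane) : Prop :=
  p ∈ X ∧ ∃ arcTo : Plane → Set Plane,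
    arcTo p = {p} ∧
    (∀ x ∈ X, x ≠ p → arcTo x ⊆ X ∧ IsArcWithEndpoints (arcTo x) x p) ∧
    (∀ (xs : ℕ → Plane) (x : Plane), (∀ n, xs n ∈ X) → x ∈ X →
      Filter.Tendsto xs Filter.atTop (nhds x) →
      Filter.Tendsto (fun n => EMetric.hausdorffEdist (arcTo (xs n)) (arcTo x))
        Filter.atTop (nhds 0))

/-- A space is zero-dimensional if it has a basis of clopen sets. -/
def IsZeroDimensionalSpace (β : Type*) [TopologicalSpace β] : Prop :=
  ∀ (x : β) (U : Set β), IsOpen U → x ∈ U → ∃ V : Set β, IsClopen V ∧ x ∈ V ∧ V ⊆ U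

/-- A space is almost zero-dimensional if it has a neighborhood basis of sets
which are intersections of clopen sets. -/
def IsAlmostZeroDimensionalSpace (β : Type*) [TopologicalSpace β] : Prop :=
  ∀ (x : β) (U : Set β), IsOpen U → x ∈ U →
    ∃ V : Set β, V ∈ nhds x ∧ V ⊆ U ∧
      ∃ 𝒞 : Set (Set β), (∀ C ∈ 𝒞, IsClopen C) ∧ V = ⋂₀ 𝒞

/-- The union of `W` with all of the bounded connected components of its complement. -/
def boundedComplementaryFill (W : Set Plane) : Set Plane :=
  W ∪ ⋃₀ {K | (∃ x ∈ Wᶜ, K = connectedComponentIn Wᶜ x) ∧ Bornology.IsBounded K}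

/-- A Bellamy dendroid: a (non-degenerate) smooth plane dendroid whose endpoint
set is connected. -/
def IsBellamyDendroid (K : Set Plane) : Prop :=
  IsDendroid K ∧ K.Nontrivial ∧ (∃ q, DendroidSmoothAt K q) ∧ IsConnected (Endpoints K)

/-- The middle-thirds Cantor set. -/
noncomputable def cantorC : Set ℝ :=
  {x | ∃ a : ℕ → Bool, x = ∑' i, (if a i then (2 : ℝ) else 0) / 3 ^ (i + 1)}

/-- `f` has a continuous logarithm on `S`. -/
def HasLogOn {α : Type*} [TopologicalSpace α] (f : α → ℂ) (S : Set α) : Prop :=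
  ∃ L : α → ℂ, ContinuousOn L S ∧ ∀ z ∈ S, Complex.exp (L z) = f z

section Log

variable {α : Type*} [TopologicalSpace α]

theorem IsPreconnected.eqOn_log {S : Set α} (hS : IsPreconnected S) {L₁ L₂ : α → ℂ}
    (h₁ : ContinuousOn L₁ S) (h₂ : ContinuousOn L₂ S)
    (h : ∀ z ∈ S, Complex.exp (L₁ z) = Complex.exp (L₂ z)) {a : α} (ha : a ∈ S)
    (haa : L₁ a = L₂ a) : EqOn L₁ L₂ S :=
  Complex.isCoveringMap_exp.eqOn_of_comp_eqOn hS h₁ h₂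
    (fun z hz => Subtype.ext (h z hz)) ha haa

theorem HasLogOn.mono {f : α → ℂ} {S T : Set α} (h : HasLogOn f S) (hT : T ⊆ S) :
    HasLogOn f T := by
  obtain ⟨L, hL, he⟩ := h
  exact ⟨L, hL.mono hT, fun z hz => he z (hT hz)⟩

theorem HasLogOn.exists_eq_at {f : α → ℂ} {S : Set α} (h : HasLogOn f S) {a : α} (ha : a ∈ S)
    {c : ℂ} (hc : Complex.exp c = f a) :
    ∃ L : α → ℂ, ContinuousOn L S ∧ (∀ z ∈ S, Complex.exp (L z) = f z) ∧ L a = c := by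
  obtain ⟨L, hL, he⟩ := h
  refine ⟨fun z => L z - L a + c, by fun_prop, fun z hz => ?_, by simp⟩
  rw [Complex.exp_add, Complex.exp_sub, he z hz, he a ha, hc]
  have : f a ≠ 0 := hc ▸ Complex.exp_ne_zero c
  field_simp

theorem HasLogOn.of_homotopy {S : Set α} {H : ℝ → α → ℂ}
    (hH : ContinuousOn (fun q : ℝ × α => H q.1 q.2) (Icc 0 1 ×ˢ S))
    (hne : ∀ t ∈ Icc (0 : ℝ) 1, ∀ z ∈ S, H t z ≠ 0) (h0 : HasLogOn (H 0) S) :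
    HasLogOn (H 1) S := by
  classical
  obtain ⟨L, hL, he⟩ := h0
  let G : C(unitInterval × S, {z : ℂ // z ≠ 0}) :=
    ⟨fun q => ⟨H q.1 q.2, hne _ q.1.2 _ q.2.2⟩, by
      refine Continuous.subtype_mk ?_ _
      exact hH.comp_continuous (f := fun q : unitInterval × S => ((q.1 : ℝ), (q.2 : α)))
        (by fun_prop) (fun q => ⟨q.1.2, q.2.2⟩)⟩
  let F : C(S, ℂ) := ⟨fun z => L z, continuousOn_iff_continuous_domRestrict.1 hL⟩
  have h0 : ∀ a : S, G (0, a) = (fun z : ℂ ↦ (⟨_, z.exp_ne_zero⟩ : {z : ℂ // z ≠ 0})) (F a) := by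
    intro a
    exact Subtype.ext (he a a.2).symm
  let Γ := Complex.isCoveringMap_exp.liftHomotopy G F h0
  have hΓ := Complex.isCoveringMap_exp.liftHomotopy_lifts G F h0
  refine ⟨fun z => if hz : z ∈ S then Γ (1, ⟨z, hz⟩) else 0, ?_, fun z hz => ?_⟩
  · rw [continuousOn_iff_continuous_domRestrict]
    have : Continuous fun z : S => Γ (1, z) := by fun_prop
    convert this using 2 with z
    simp
  · have : Complex.exp (Γ (1, ⟨z, hz⟩)) = H ((1 : unitInterval) : ℝ) z :=
      congrArg Subtype.val (congrFun hΓ (1, ⟨z, hz⟩))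
    simp only [dif_pos hz]
    exact this

/-- Gluing logarithms on two closed sets whose intersection is connected. -/
theorem HasLogOn.union {f : α → ℂ} {A B : Set α} (hA : IsClosed A) (hB : IsClosed B)
    (hAB : IsPreconnected (A ∩ B)) (h₁ : HasLogOn f A) (h₂ : HasLogOn f B) :
    HasLogOn f (A ∪ B) := by
  classical
  obtain ⟨L, hL, he⟩ := h₁
  obtain ⟨L', hL', he', hEq⟩ : ∃ L' : α → ℂ, ContinuousOn L' B ∧
      (∀ z ∈ B, Complex.exp (L' z) = f z) ∧ EqOn L L' (A ∩ B) := by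
    rcases (A ∩ B).eq_empty_or_nonempty with h | ⟨a, ha⟩
    · obtain ⟨L', hL', he'⟩ := h₂
      exact ⟨L', hL', he', by simp [h]⟩
    · obtain ⟨L', hL', he', ha'⟩ := h₂.exists_eq_at ha.2 (he a ha.1)
      exact ⟨L', hL', he', hAB.eqOn_log (hL.mono inter_subset_left) (hL'.mono inter_subset_right)
        (fun z hz => (he z hz.1).trans (he' z hz.2).symm) ha ha'.symm⟩
  have hEA : EqOn (A.piecewise L L') L A := fun z hz => by simp [hz]
  have hEB : EqOn (A.piecewise L L') L' B := fun z hz => by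
    by_cases hzA : z ∈ A
    · simp [hzA, hEq ⟨hzA, hz⟩]
    · simp [hzA]
  refine ⟨A.piecewise L L', (hL.congr hEA).union_of_isClosed (hL'.congr hEB) hA hB, ?_⟩
  rintro z (hz | hz)
  · rw [hEA hz, he z hz]
  · rw [hEB hz, he' z hz]

theorem IsArcWithEndpoints.isCompact {A : Set α} {a b : α} (h : IsArcWithEndpoints A a b) :
    IsCompact A := by
  obtain ⟨f, hf, -, rfl, -⟩ := h
  exact isCompact_Icc.image_of_continuousOn hf

theorem IsArcWithEndpoints.isPreconnected {A : Set α} {a b : α} (h : IsArcWithEndpoints A a b) :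
    IsPreconnected A := by
  obtain ⟨f, hf, -, rfl, -⟩ := h
  exact isPreconnected_Icc.image f hf

theorem IsArcWithEndpoints.left_mem {A : Set α} {a b : α} (h : IsArcWithEndpoints A a b) :
    a ∈ A := by
  obtain ⟨f, -, -, rfl, rfl, -⟩ := h
  exact mem_image_of_mem f (by simp)

theorem IsArcWithEndpoints.right_mem {A : Set α} {a b : α} (h : IsArcWithEndpoints A a b) :
    b ∈ A := by
  obtain ⟨f, -, -, rfl, -, rfl⟩ := h
  exact mem_image_of_mem f (by simp)

theorem IsCompact.continuousOn_of_comp_eqOn {β γ δ : Type*} [TopologicalSpace β]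
    [TopologicalSpace γ] [T2Space γ] [TopologicalSpace δ] {s : Set β} (hs : IsCompact s)
    {f : β → γ} (hf : ContinuousOn f s) {k : β → δ} (hk : ContinuousOn k s) {g : γ → δ}
    (hg : EqOn (g ∘ f) k s) : ContinuousOn g (f '' s) := by
  rw [continuousOn_iff_isClosed]
  intro t ht
  obtain ⟨u, hu, hut⟩ := continuousOn_iff_isClosed.1 hk t ht
  refine ⟨f '' (u ∩ s), ((hs.inter_left hu).image_of_continuousOn
    (hf.mono inter_subset_right)).isClosed, ?_⟩
  ext z
  constructor
  · rintro ⟨hz, x, hx, rfl⟩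
    have : k x ∈ t := hg hx ▸ hz
    exact ⟨mem_image_of_mem f (hut.subset ⟨this, hx⟩), mem_image_of_mem f hx⟩
  · rintro ⟨⟨x, hx, rfl⟩, hz⟩
    have : k x ∈ t := (hut.symm.subset hx).1
    exact ⟨by rwa [mem_preimage, ← Function.comp_apply (f := g), hg hx.2], hz⟩

theorem continuousOn_invFunOn_image {β γ : Type*} [TopologicalSpace β] [TopologicalSpace γ]
    [Nonempty β] [T2Space γ] {f : β → γ} {s : Set β} (hs : IsCompact s) (hf : ContinuousOn f s)
    (hi : InjOn f s) : ContinuousOn (Function.invFunOn f s) (f '' s) :=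
  hs.continuousOn_of_comp_eqOn hf continuousOn_id hi.leftInvOn_invFunOn

theorem hasLogOn_Icc {f : ℝ → ℂ} (hf : ContinuousOn f (Icc 0 1))
    (hne : ∀ t ∈ Icc (0 : ℝ) 1, f t ≠ 0) : HasLogOn f (Icc 0 1) := by
  have h0 : (0 : ℝ) ∈ Icc (0 : ℝ) 1 := by simp
  have := HasLogOn.of_homotopy (S := Icc (0 : ℝ) 1) (H := fun s t => f (s * t)) ?_ ?_ ?_
  · simpa using this
  · refine hf.comp (by fun_prop) ?_
    rintro ⟨s, t⟩ ⟨hs, ht⟩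
    exact ⟨mul_nonneg hs.1 ht.1, mul_le_one₀ hs.2 ht.1 ht.2⟩
  · intro s hs t ht
    exact hne _ ⟨mul_nonneg hs.1 ht.1, mul_le_one₀ hs.2 ht.1 ht.2⟩
  · exact ⟨fun _ => Complex.log (f 0), continuousOn_const, fun z _ => by
      simp [Complex.exp_log (hne 0 h0)]⟩

theorem IsArcWithEndpoints.hasLogOn [T2Space α] {A : Set α} {a b : α}
    (h : IsArcWithEndpoints A a b) {f : α → ℂ} (hf : ContinuousOn f A)
    (hne : ∀ z ∈ A, f z ≠ 0) : HasLogOn f A := by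
  obtain ⟨g, hg, hi, rfl, -, -⟩ := h
  obtain ⟨L, hL, he⟩ := hasLogOn_Icc (hf.comp hg (mapsTo_image _ _))
    (fun t ht => hne _ (mem_image_of_mem g ht))
  refine ⟨L ∘ Function.invFunOn g (Icc 0 1), hL.comp (continuousOn_invFunOn_image isCompact_Icc hg
    hi) fun z hz => Function.invFunOn_mem hz, fun z hz => ?_⟩
  rw [Function.comp_apply, he _ (Function.invFunOn_mem hz), Function.comp_apply,
    Function.invFunOn_eq hz]

end Log

/-- The translation `z ↦ z - x` has no continuous logarithm on a circle centred at `x`. -/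
theorem not_hasLogOn_sphere (x : ℂ) {R : ℝ} (hR : 0 < R) :
    ¬ HasLogOn (fun z => z - x) (Metric.sphere x R) := by
  rintro ⟨L, hL, he⟩
  have hmem : ∀ t : ℝ, x + R * Complex.exp (t * Complex.I) ∈ Metric.sphere x R := by
    intro t
    simp [Complex.norm_exp_ofReal_mul_I, abs_of_pos hR]
  have hc : Continuous fun t : ℝ => L (x + R * Complex.exp (t * Complex.I)) :=
    hL.comp_continuous (by fun_prop) hmem
  have := (isPreconnected_univ (α := ℝ)).eqOn_log (a := 0)
    (L₁ := fun t : ℝ => L (x + R * Complex.exp (t * Complex.I)))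
    (L₂ := fun t : ℝ => L (x + R) + t * Complex.I) hc.continuousOn
    (by fun_prop) ?_ (mem_univ _) (by simp)
  · have h := this (mem_univ (2 * Real.pi))
    simp [Complex.exp_two_pi_mul_I, Real.pi_ne_zero] at h
  · intro t _
    have h0 := he _ (hmem 0)
    simp only [Complex.ofReal_zero, zero_mul, Complex.exp_zero, mul_one] at h0
    rw [he _ (hmem t), Complex.exp_add, h0]
    simp

theorem hasLogOn_of_ne_zero {h : ℂ → ℂ} (hc : Continuous h) (hne : ∀ z, h z ≠ 0) :
    HasLogOn h univ := by
  have := HasLogOn.of_homotopy (S := (univ : Set ℂ)) (H := fun s z => h (s * z)) (by fun_prop)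
    (fun _ _ _ _ => hne _)
    ⟨fun _ => Complex.log (h 0), continuousOn_const, fun z _ => by simp [Complex.exp_log (hne 0)]⟩
  simpa using this

theorem exists_continuous_extension {α : Type*} [TopologicalSpace α] [NormalSpace α] {A : Set α}
    (hA : IsClosed A) {L : α → ℂ} (hL : ContinuousOn L A) :
    ∃ F : α → ℂ, Continuous F ∧ EqOn F L A := by
  obtain ⟨F, hF⟩ := ContinuousMap.exists_restrict_eq hA
    (⟨fun z => L z, continuousOn_iff_continuous_domRestrict.1 hL⟩ : C(A, ℂ))
  exact ⟨F, F.continuous, fun z hz => congrArg (fun g : C(A, ℂ) => g ⟨z, hz⟩) hF⟩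

/-- Eilenberg's criterion: a bounded open set whose frontier carries a logarithm of
`(z - x) / (z - y)` cannot separate `x` from `y`. -/
theorem HasLogOn.mem_of_frontier_subset {K D : Set ℂ} (hK : IsClosed K)
    (hDb : Bornology.IsBounded D) (hDK : frontier D ⊆ K) {x y : ℂ} (hx : x ∈ D) (hxK : x ∉ K)
    (hyK : y ∉ K) (h : HasLogOn (fun z => (z - x) / (z - y)) K) : y ∈ D := by
  classical
  by_contra hy
  obtain ⟨L, hL, he⟩ := h
  obtain ⟨F, hF, hFL⟩ := exists_continuous_extension hK hL
  have hclos : closure D ⊆ D ∪ K := fun z hz => by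
    by_cases hzD : z ∈ interior D
    · exact Or.inl (interior_subset hzD)
    · exact Or.inr (hDK ⟨hz, hzD⟩)
  let h : ℂ → ℂ := fun z => if z ∈ closure D then (z - y) * Complex.exp (F z) else z - x
  have hc : Continuous h := by
    refine Continuous.if (fun z hz => ?_) (by fun_prop) (by fun_prop)
    have hzK : z ∈ K := hDK (frontier_closure_subset hz)
    have : z - y ≠ 0 := sub_ne_zero.2 fun h => hyK (h ▸ hzK)
    rw [hFL hzK, he z hzK]
    field_simp
  have hne : ∀ z, h z ≠ 0 := by
    intro z
    by_cases hz : z ∈ closure D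
    · have : z ≠ y := by
        rintro rfl
        exact (hclos hz).elim hy hyK
      simp [h, hz, sub_ne_zero, this]
    · have : z ≠ x := by
        rintro rfl
        exact hz (subset_closure hx)
      simp [h, hz, sub_ne_zero, this]
  obtain ⟨R, hR0, hR⟩ := (hDb.closure).subset_ball_lt 0 x
  obtain ⟨M, hM, hMe⟩ := (hasLogOn_of_ne_zero hc hne).mono (subset_univ (Metric.sphere x R))
  refine not_hasLogOn_sphere x hR0 ⟨M, hM, fun z hz => ?_⟩
  have : z ∉ closure D := fun hzD => by
    have := hR hzD
    rw [Metric.mem_ball, Metric.mem_sphere.1 hz] at this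
    exact lt_irrefl _ this
  rw [hMe z hz]
  simp [h, this]

theorem frontier_connectedComponentIn_compl_subset {K : Set ℂ} (hK : IsClosed K) (x : ℂ) :
    frontier (connectedComponentIn Kᶜ x) ⊆ K := by
  intro z hz
  by_contra hzK
  have hopen := hK.isOpen_compl.connectedComponentIn (x := z)
  have hmem : z ∈ connectedComponentIn Kᶜ z := mem_connectedComponentIn hzK
  obtain ⟨w, hwz, hwx⟩ := mem_closure_iff.1 hz.1 _ hopen hmem
  rw [hK.isOpen_compl.connectedComponentIn.frontier_eq] at hz
  refine hz.2 ?_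
  rwa [connectedComponentIn_eq hwx, ← connectedComponentIn_eq hwz]

/-- Points close to `e` off a compact set `X` all of whose nonvanishing maps have logarithms can be
joined near `e` in the complement, provided `X` is colocally connected at `e`. -/
theorem exists_joinedIn_ball_diff {X M : Set ℂ} (hX : IsCompact X)
    (hlog : ∀ f : ℂ → ℂ, ContinuousOn f X → (∀ z ∈ X, f z ≠ 0) → HasLogOn f X)
    (hM : IsClosed M) (hMX : M ⊆ X) (hMc : IsPreconnected M) {e : ℂ} {ε : ℝ} (hε : 0 < ε)
    (heM : e ∉ M) (hXM : X \ Metric.ball e ε ⊆ M) :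
    ∃ δ > 0, ∀ x ∈ Metric.ball e δ \ X, ∀ y ∈ Metric.ball e δ \ X,
      JoinedIn (Metric.ball e ε \ X) x y := by
  obtain ⟨δ₀, hδ₀, hδM⟩ := Metric.isOpen_iff.1 hM.isOpen_compl e heM
  refine ⟨min δ₀ ε, lt_min hδ₀ hε, fun x hx y hy => ?_⟩
  obtain ⟨R, hεR, -⟩ := hX.isBounded.subset_ball_lt ε e
  set B : Set ℂ := M ∪ (Metric.closedBall e R \ Metric.ball e ε) with hB
  have hBcl : IsClosed B := hM.union (Metric.isClosed_closedBall.sdiff Metric.isOpen_ball)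
  have hBδ : ∀ z ∈ B, z ∉ Metric.ball e (min δ₀ ε) := by
    rintro z (hz | hz) hze
    · exact hδM (Metric.ball_subset_ball (min_le_left _ _) hze) hz
    · exact hz.2 (Metric.ball_subset_ball (min_le_right _ _) hze)
  have hXB : X ∩ B = M := by
    ext z
    constructor
    · rintro ⟨hzX, hz | hz⟩
      · exact hz
      · exact hXM ⟨hzX, hz.2⟩
    · exact fun hz => ⟨hMX hz, Or.inl hz⟩
  have hlogX : HasLogOn (fun z => (z - x) / (z - y)) X := by
    have hy' : ∀ z ∈ X, z - y ≠ 0 := fun z hz => sub_ne_zero.2 fun h => hy.2 (h ▸ hz)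
    have hx' : ∀ z ∈ X, z - x ≠ 0 := fun z hz => sub_ne_zero.2 fun h => hx.2 (h ▸ hz)
    exact hlog _ (ContinuousOn.div (by fun_prop) (by fun_prop) hy')
      fun z hz => div_ne_zero (hx' z hz) (hy' z hz)
  have hlogB : HasLogOn (fun z => (z - x) / (z - y)) B := by
    have hy' : ∀ z ∈ B, z - y ≠ 0 := fun z hz => sub_ne_zero.2 fun h => hBδ z hz (h ▸ hy.1)
    have := HasLogOn.of_homotopy (S := B)
      (H := fun t z => (z - (y + t * (x - y))) / (z - y)) ?_ ?_ ?_
    · simpa using this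
    · exact ContinuousOn.div (by fun_prop) (by fun_prop) fun q hq => hy' _ hq.2
    · intro t ht z hz
      refine div_ne_zero (sub_ne_zero.2 fun h => hBδ z hz ?_) (hy' z hz)
      rw [h]
      exact (convex_ball e _).add_smul_sub_mem hy.1 hx.1 ht
    · refine ⟨fun _ => 0, continuousOn_const, fun z hz => ?_⟩
      simp [div_self (hy' z hz)]
  have hlogK : HasLogOn (fun z => (z - x) / (z - y)) (X ∪ B) :=
    hlogX.union hX.isClosed hBcl (hXB ▸ hMc) hlogB
  have hKcl : IsClosed (X ∪ B) := hX.isClosed.union hBcl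
  have hxK : x ∉ X ∪ B := fun h => h.elim hx.2 fun h => hBδ x h hx.1
  have hyK : y ∉ X ∪ B := fun h => h.elim hy.2 fun h => hBδ y h hy.1
  set D := connectedComponentIn (X ∪ B)ᶜ x
  have hDsub : D ⊆ (X ∪ B)ᶜ := connectedComponentIn_subset _ _
  have hxD : x ∈ D := mem_connectedComponentIn hxK
  have hDε : D ⊆ Metric.ball e ε := by
    refine isPreconnected_connectedComponentIn.subset_left_of_subset_union
      (v := (Metric.closedBall e R)ᶜ) Metric.isOpen_ball
      Metric.isClosed_closedBall.isOpen_compl ?_ ?_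
      ⟨x, hxD, Metric.ball_subset_ball (min_le_right _ _) hx.1⟩
    · rw [disjoint_compl_right_iff_subset]
      exact Metric.ball_subset_closedBall.trans
        (Metric.closedBall_subset_closedBall hεR.le)
    · intro z hz
      by_contra hz'
      simp only [mem_union, not_or, mem_compl_iff, not_not] at hz'
      refine hDsub hz (Or.inr (Or.inr ⟨hz'.2, hz'.1⟩))
  have hyD : y ∈ D := hlogK.mem_of_frontier_subset hKcl (Metric.isBounded_ball.subset hDε)
    (frontier_connectedComponentIn_compl_subset hKcl x) hxD hxK hyK
  have hDo : IsOpen D := hKcl.isOpen_compl.connectedComponentIn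
  have hDp : IsPathConnected D :=
    hDo.isConnected_iff_isPathConnected.1 ⟨⟨x, hxD⟩, isPreconnected_connectedComponentIn⟩
  exact (hDp.joinedIn x hxD y hyD).mono fun z hz => ⟨hDε hz, fun h => hDsub hz (Or.inl h)⟩

section Smooth

variable {α : Type*} [MetricSpace α] {X : Set α} {arcTo : α → Set α}

theorem eventually_arcTo_subset
    (hs : ∀ (xs : ℕ → α) (x : α), (∀ n, xs n ∈ X) → x ∈ X → Tendsto xs atTop (𝓝 x) →
      Tendsto (fun n => Metric.hausdorffEDist (arcTo (xs n)) (arcTo x)) atTop (𝓝 0))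
    {x : α} (hx : x ∈ X) (hc : IsCompact (arcTo x)) {N : Set α} (hN : IsOpen N)
    (hxN : arcTo x ⊆ N) : ∀ᶠ y in 𝓝[X] x, arcTo y ⊆ N := by
  by_contra hcon
  obtain ⟨xs, hxs, hP⟩ := exists_seq_forall_of_frequently
    ((not_eventually.1 hcon).and_eventually self_mem_nhdsWithin)
  obtain ⟨δ, hδ, hδN⟩ := hc.exists_thickening_subset_open hN hxN
  have := hs xs x (fun n => (hP n).2) hx (hxs.mono_right nhdsWithin_le_nhds)
  obtain ⟨n, hn⟩ := (this.eventually (gt_mem_nhds (ENNReal.ofReal_pos.2 hδ))).exists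
  exact (hP n).1 fun z hz =>
    hδN ((Metric.infEDist_le_hausdorffEDist_of_mem hz).trans_lt hn)

theorem isClosed_biUnion_arcTo
    (hs : ∀ (xs : ℕ → α) (x : α), (∀ n, xs n ∈ X) → x ∈ X → Tendsto xs atTop (𝓝 x) →
      Tendsto (fun n => Metric.hausdorffEDist (arcTo (xs n)) (arcTo x)) atTop (𝓝 0))
    (hc : ∀ x ∈ X, IsCompact (arcTo x)) {K : Set α} (hK : IsCompact K) (hKX : K ⊆ X) :
    IsClosed (⋃ x ∈ K, arcTo x) := by
  rw [← isOpen_compl_iff, isOpen_iff_mem_nhds]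
  intro y hy
  have hy' : ∀ x ∈ K, y ∉ arcTo x := by simpa using hy
  have := hK.eventually_forall_of_forall_eventually (x₀ := y)
    (P := fun y' x' => x' ∈ X → y' ∉ arcTo x') ?_
  · filter_upwards [this] with z hz
    simpa using fun x hx => hz x hx (hKX hx)
  · intro x hx
    obtain ⟨U, V, hU, hV, hxU, hyV, hUV⟩ := SeparatedNhds.of_isCompact_isCompact
      (hc x (hKX hx)) isCompact_singleton (disjoint_singleton_right.2 (hy' x hx))
    have h1 := eventually_nhdsWithin_iff.1
      (eventually_arcTo_subset hs (hKX hx) (hc x (hKX hx)) hU hxU)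
    have h2 : ∀ᶠ y' in 𝓝 y, y' ∈ V := hV.mem_nhds (hyV rfl)
    rw [nhds_prod_eq]
    filter_upwards [h2.prod_mk h1] with q hq hqX hmem
    exact disjoint_left.1 hUV (hq.2 hqX hmem) hq.1

/-- On a smooth fan of arcs every nonvanishing map has a continuous logarithm. -/
theorem hasLogOn_of_arcTo
    (hs : ∀ (xs : ℕ → α) (x : α), (∀ n, xs n ∈ X) → x ∈ X → Tendsto xs atTop (𝓝 x) →
      Tendsto (fun n => Metric.hausdorffEDist (arcTo (xs n)) (arcTo x)) atTop (𝓝 0))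
    {p : α} (hp : p ∈ X) (hpp : arcTo p = {p})
    (harc : ∀ x ∈ X, x ≠ p → arcTo x ⊆ X ∧ IsArcWithEndpoints (arcTo x) x p)
    {f : α → ℂ} (hf : ContinuousOn f X) (hne : ∀ z ∈ X, f z ≠ 0) : HasLogOn f X := by
  have key : ∀ x ∈ X, x ∈ arcTo x ∧ p ∈ arcTo x ∧ arcTo x ⊆ X ∧ IsCompact (arcTo x) ∧
      IsPreconnected (arcTo x) ∧ HasLogOn f (arcTo x) := by
    intro x hx
    by_cases hxp : x = p
    · subst hxp
      rw [hpp]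
      refine ⟨rfl, rfl, singleton_subset_iff.2 hx, isCompact_singleton, isPreconnected_singleton,
        fun _ => Complex.log (f x), continuousOn_const, ?_⟩
      rintro z rfl
      exact Complex.exp_log (hne _ hx)
    · obtain ⟨h1, h2⟩ := harc x hx hxp
      exact ⟨h2.left_mem, h2.right_mem, h1, h2.isCompact, h2.isPreconnected,
        h2.hasLogOn (hf.mono h1) fun z hz => hne z (h1 hz)⟩
  have hlog : ∀ x, ∃ L : α → ℂ, x ∈ X → ContinuousOn L (arcTo x) ∧
      (∀ z ∈ arcTo x, Complex.exp (L z) = f z) ∧ L p = Complex.log (f p) := by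
    intro x
    by_cases hx : x ∈ X
    · obtain ⟨L, hL⟩ := (key x hx).2.2.2.2.2.exists_eq_at (key x hx).2.1
        (Complex.exp_log (hne p hp))
      exact ⟨L, fun _ => hL⟩
    · exact ⟨0, fun h => absurd h hx⟩
  choose L hL using hlog
  refine ⟨fun x => L x x, fun x hx => ?_, fun x hx => (hL x hx).2.1 x (key x hx).1⟩
  obtain ⟨hLc, hLe, hLp⟩ := hL x hx
  obtain ⟨hxm, hpm, hsub, hcomp, -, -⟩ := key x hx
  obtain ⟨F, hF, hFL⟩ := exists_continuous_extension hcomp.isClosed hLc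
  set g : α → ℂ := fun u => f u * Complex.exp (-F u) with hg
  have hgc : ContinuousOn g X := by fun_prop
  have hg1 : ∀ u ∈ arcTo x, g u = 1 := fun u hu => by
    rw [hg]
    simp only
    rw [hFL hu, ← hLe u hu, ← Complex.exp_add, add_neg_cancel, Complex.exp_zero]
  obtain ⟨N, hN, hNX⟩ := continuousOn_iff'.1 hgc Complex.slitPlane Complex.isOpen_slitPlane
  have hN' : ∀ u ∈ X, u ∈ N → g u ∈ Complex.slitPlane := fun u hu huN =>
    (hNX.symm.subset ⟨huN, hu⟩).1
  have hxN : arcTo x ⊆ N := fun u hu =>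
    (hNX.subset ⟨by rw [mem_preimage, hg1 u hu]; exact Complex.one_mem_slitPlane, hsub hu⟩).1
  have hL'c : ∀ u ∈ X, u ∈ N → ContinuousWithinAt (fun u => F u + Complex.log (g u)) X u :=
    fun u hu huN => hF.continuousWithinAt.add ((hgc u hu).clog (hN' u hu huN))
  have hev : (fun u => L u u) =ᶠ[𝓝[X] x] fun u => F u + Complex.log (g u) := by
    filter_upwards [eventually_arcTo_subset hs hx hcomp hN hxN, self_mem_nhdsWithin] with u hu huX
    obtain ⟨hum, hupm, husub, -, hupre, -⟩ := key u huX
    refine hupre.eqOn_log (hL u huX).1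
      (fun v hv => (hL'c v (husub hv) (hu hv)).mono husub) (fun v hv => ?_) hupm ?_ hum
    · have : f v ≠ 0 := hne v (husub hv)
      rw [(hL u huX).2.1 v hv, Complex.exp_add, Complex.exp_log (by simp [hg, this]), hg]
      simp only
      rw [mul_left_comm, ← Complex.exp_add, add_neg_cancel, Complex.exp_zero, mul_one]
    · rw [(hL u huX).2.2, hg1 p hpm, hFL hpm, hLp, Complex.log_one, add_zero]
  exact (hL'c x hx (hxN hxm)).congr_of_eventuallyEq hev (hev.eq_of_nhdsWithin hx)

end Smooth

theorem IsArcWithEndpoints.eq_or_eq {α : Type*} [TopologicalSpace α] [T2Space α] {A : Set α}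
    {a b e c : α} (h : IsArcWithEndpoints A a b) (h' : IsArcWithEndpoints A e c) :
    e = a ∨ e = b := by
  obtain ⟨f, hf, hfi, rfl, rfl, rfl⟩ := h
  obtain ⟨g, hg, hgi, hgA, rfl, rfl⟩ := h'
  have h01 : Ioc (0 : ℝ) 1 ⊆ Icc 0 1 := Ioc_subset_Icc_self
  have hmaps : MapsTo g (Icc 0 1) (f '' Icc 0 1) := hgA ▸ mapsTo_image g _
  obtain ⟨s, hs, hsg⟩ := hmaps (left_mem_Icc.2 zero_le_one)
  have hinv := continuousOn_invFunOn_image isCompact_Icc hf hfi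
  have hpre := (isPreconnected_Ioc (a := (0 : ℝ)) (b := 1)).image _
    ((hinv.comp hg hmaps).mono h01)
  have hmem : ∀ t ∈ Icc (0 : ℝ) 1, t ≠ s →
      t ∈ (Function.invFunOn f (Icc 0 1) ∘ g) '' Ioc 0 1 := by
    intro t ht hts
    obtain ⟨u, hu, hut⟩ := hgA.symm.subset (mem_image_of_mem f ht)
    refine ⟨u, ⟨lt_of_le_of_ne hu.1 ?_, hu.2⟩, ?_⟩
    · rintro rfl
      exact hts (hfi ht hs (hut.symm.trans hsg.symm))
    · rw [Function.comp_apply, hut, hfi.leftInvOn_invFunOn ht]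
  by_cases h0 : s = 0
  · exact Or.inl (by rw [← hsg, h0])
  by_cases h1 : s = 1
  · exact Or.inr (by rw [← hsg, h1])
  obtain ⟨u, hu, hus⟩ := hpre.ordConnected.out (hmem 0 (by simp) (Ne.symm h0))
    (hmem 1 (by simp) (Ne.symm h1)) hs
  have h2 : g u = f s := by
    rw [← hus, Function.comp_apply, Function.invFunOn_eq (hmaps (h01 hu))]
  exact absurd (hgi (h01 hu) (left_mem_Icc.2 zero_le_one) (h2.trans hsg)) hu.1.ne'

/-- Smooth dendroids are colocally connected at endpoints other than the initial point. -/
theorem exists_colocal_subcontinuum {α : Type*} [MetricSpace α] {X : Set α} {arcTo : α → Set α}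
    (hX : IsCompact X)
    (hs : ∀ (xs : ℕ → α) (x : α), (∀ n, xs n ∈ X) → x ∈ X → Tendsto xs atTop (𝓝 x) →
      Tendsto (fun n => Metric.hausdorffEDist (arcTo (xs n)) (arcTo x)) atTop (𝓝 0))
    {p : α} (hpp : arcTo p = {p})
    (harc : ∀ x ∈ X, x ≠ p → arcTo x ⊆ X ∧ IsArcWithEndpoints (arcTo x) x p)
    {e : α} (he : e ∈ Endpoints X) (hep : e ≠ p) {ε : ℝ} (hε : 0 < ε) :
    ∃ M ⊆ X, IsClosed M ∧ IsPreconnected M ∧ e ∉ M ∧ X \ Metric.ball e ε ⊆ M := by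
  have key : ∀ x ∈ X, x ∈ arcTo x ∧ p ∈ arcTo x ∧ arcTo x ⊆ X ∧ IsCompact (arcTo x) ∧
      IsPreconnected (arcTo x) := by
    intro x hx
    by_cases hxp : x = p
    · subst hxp
      rw [hpp]
      exact ⟨rfl, rfl, singleton_subset_iff.2 hx, isCompact_singleton, isPreconnected_singleton⟩
    · obtain ⟨h1, h2⟩ := harc x hx hxp
      exact ⟨h2.left_mem, h2.right_mem, h1, h2.isCompact, h2.isPreconnected⟩
  have hKX : X \ Metric.ball e ε ⊆ X := sdiff_subset
  refine ⟨⋃ x ∈ X \ Metric.ball e ε, arcTo x, iUnion₂_subset fun x hx => (key x hx.1).2.2.1,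
    isClosed_biUnion_arcTo hs (fun x hx => (key x hx).2.2.2.1) (hX.diff Metric.isOpen_ball) hKX,
    ?_, ?_, fun x hx => mem_biUnion hx (key x hx.1).1⟩
  · rw [biUnion_eq_iUnion]
    exact isPreconnected_iUnion ⟨p, mem_iInter.2 fun x => (key x x.2.1).2.1⟩
      fun x => (key x x.2.1).2.2.2.2
  · intro hmem
    obtain ⟨x, hx, hex⟩ := mem_iUnion₂.1 hmem
    have hxe : x ≠ e := by
      rintro rfl
      exact hx.2 (Metric.mem_ball_self hε)
    by_cases hxp : x = p
    · subst hxp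
      rw [hpp] at hex
      exact hep hex
    · obtain ⟨h1, h2⟩ := harc x hx.1 hxp
      obtain ⟨b, hb⟩ := he.2 _ h1 ⟨x, p, h2⟩ hex
      exact (h2.eq_or_eq hb).elim (fun h => hxe h.symm) hep

/-- A hereditarily unicoherent plane set has empty interior. -/
theorem HereditarilyUnicoherent.not_ball_subset {X : Set Plane} (hX : HereditarilyUnicoherent X)
    (c : Plane) {r : ℝ} (hr : 0 < r) : ¬ Metric.ball c r ⊆ X := by
  intro hsub
  let φ : ℂ ≃ₗᵢ[ℝ] Plane := Complex.orthonormalBasisOneI.repr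
  let γ : ℝ → ℝ → Plane := fun s θ => c + φ ((r / 2 : ℝ) * Complex.exp ((s * θ : ℝ) * Complex.I))
  have hγ : ∀ s, Continuous (γ s) := fun s => by
    have := φ.continuous
    fun_prop
  have hγX : ∀ s, γ s '' Icc 0 Real.pi ⊆ X := by
    rintro s _ ⟨θ, -, rfl⟩
    refine hsub ?_
    have : ‖Complex.exp (↑s * ↑θ * Complex.I)‖ = 1 := by
      rw [← Complex.ofReal_mul, Complex.norm_exp_ofReal_mul_I]
    simp [γ, this, abs_of_pos hr, hr]
  have hcomp : ∀ s, IsCompact (γ s '' Icc 0 Real.pi) := fun s => isCompact_Icc.image (hγ s)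
  have hconn : ∀ s, IsConnected (γ s '' Icc 0 Real.pi) := fun s =>
    (isConnected_Icc Real.pi_pos.le).image _ (hγ s).continuousOn
  have hpre := hX _ _ (hγX 1) (hγX (-1)) (hcomp 1) (hconn 1) (hcomp (-1)) (hconn (-1))
  have hpre' := hpre.image (fun z => (φ.symm (z - c)).re)
    (by have := φ.symm.continuous; fun_prop)
  have hval : ∀ s θ, φ.symm (γ s θ - c) = (r / 2 : ℝ) * Complex.exp ((s * θ : ℝ) * Complex.I) := by
    intro s θ
    simp [γ]
  have hre : ∀ s θ, (φ.symm (γ s θ - c)).re = r / 2 * Real.cos (s * θ) := by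
    intro s θ
    rw [hval, Complex.re_ofReal_mul, Complex.exp_ofReal_mul_I_re]
  have him : ∀ s θ, (φ.symm (γ s θ - c)).im = r / 2 * Real.sin (s * θ) := by
    intro s θ
    rw [hval, Complex.im_ofReal_mul, Complex.exp_ofReal_mul_I_im]
  have hpi := Real.pi_pos.le
  have h1 : r / 2 ∈ (fun z => (φ.symm (z - c)).re) ''
      (γ 1 '' Icc 0 Real.pi ∩ γ (-1) '' Icc 0 Real.pi) :=
    ⟨γ 1 0, ⟨⟨0, ⟨le_rfl, hpi⟩, rfl⟩, ⟨0, ⟨le_rfl, hpi⟩, by simp [γ]⟩⟩, (hre 1 0).trans (by simp)⟩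
  have h2 : -(r / 2) ∈ (fun z => (φ.symm (z - c)).re) ''
      (γ 1 '' Icc 0 Real.pi ∩ γ (-1) '' Icc 0 Real.pi) :=
    ⟨γ 1 Real.pi, ⟨⟨Real.pi, ⟨hpi, le_rfl⟩, rfl⟩, ⟨Real.pi, ⟨hpi, le_rfl⟩, by
      simp [γ, Complex.exp_neg, Complex.exp_pi_mul_I]⟩⟩, (hre 1 Real.pi).trans (by simp)⟩
  obtain ⟨z, ⟨⟨θ, hθ, rfl⟩, ⟨η, hη, hηθ⟩⟩, hz⟩ :=
    hpre'.ordConnected.out h2 h1 (show (0 : ℝ) ∈ Icc (-(r / 2)) (r / 2) by constructor <;> linarith)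
  have hsθ := Real.sin_nonneg_of_nonneg_of_le_pi hθ.1 hθ.2
  have hsη := Real.sin_nonneg_of_nonneg_of_le_pi hη.1 hη.2
  have h3 := him 1 θ
  rw [← hηθ, him] at h3
  simp only [hre, one_mul] at hz h3
  rw [neg_one_mul, Real.sin_neg] at h3
  have hr2 : r / 2 ≠ 0 := by positivity
  have hcos : Real.cos θ = 0 := (mul_eq_zero.1 hz).resolve_left hr2
  have hsin : Real.sin θ = 0 := by linarith [mul_left_cancel₀ hr2 h3]
  simpa [hcos, hsin] using Real.sin_sq_add_cos_sq θ

section ArcOfPath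

/-- The closed sets of times obtained by excising loops from the path `γ`. -/
def loopExcisions {α : Type*} (γ : ℝ → α) : Set (Set ℝ) :=
  {C | C ⊆ Icc 0 1 ∧ IsClosed C ∧ 0 ∈ C ∧ 1 ∈ C ∧
    ∀ a ∈ C, ∀ b ∈ C, a < b → Disjoint (Ioo a b) C → γ a = γ b}

variable {α : Type*} [MetricSpace α] {γ : ℝ → α}

theorem exists_gap_of_disjoint {C : Set ℝ} (hC : IsCompact C) {a b c d : ℝ} (ha : a ∈ C)
    (hb : b ∈ C) (hac : a < c) (hcd : c ≤ d) (hdb : d < b) (hdisj : Disjoint (Icc c d) C) :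
    ∃ a' ∈ C, ∃ b' ∈ C, a ≤ a' ∧ a' < c ∧ d < b' ∧ b' ≤ b ∧ Disjoint (Ioo a' b') C := by
  obtain ⟨a', ha', ha'max⟩ := (hC.inter_right (isClosed_Iic (a := c))).exists_isGreatest
    ⟨a, ha, hac.le⟩
  obtain ⟨b', hb', hb'min⟩ := (hC.inter_right (isClosed_Ici (a := d))).exists_isLeast
    ⟨b, hb, hdb.le⟩
  refine ⟨a', ha'.1, b', hb'.1, ha'max ⟨ha, hac.le⟩, lt_of_le_of_ne ha'.2 ?_,
    lt_of_le_of_ne hb'.2 ?_, hb'min ⟨hb, hdb.le⟩, ?_⟩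
  · rintro rfl
    exact disjoint_left.1 hdisj ⟨le_rfl, hcd⟩ ha'.1
  · rintro rfl
    exact disjoint_left.1 hdisj ⟨hcd, le_rfl⟩ hb'.1
  · refine disjoint_left.2 fun u hu huC => ?_
    rcases le_or_gt u c with h | h
    · exact (ha'max ⟨huC, h⟩).not_gt hu.1
    rcases le_or_gt d u with h' | h'
    · exact (hb'min ⟨huC, h'⟩).not_gt hu.2
    · exact disjoint_left.1 hdisj ⟨h.le, h'.le⟩ huC

theorem sInter_mem_loopExcisions (hγ : ContinuousOn γ (Icc 0 1)) {c : Set (Set ℝ)}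
    (hc : c ⊆ loopExcisions γ) (hchain : IsChain (· ⊆ ·) c) (hne : c.Nonempty) :
    ⋂₀ c ∈ loopExcisions γ := by
  obtain ⟨C₀, hC₀⟩ := hne
  have hsub : ⋂₀ c ⊆ Icc 0 1 := (sInter_subset_of_mem hC₀).trans (hc hC₀).1
  refine ⟨hsub, isClosed_sInter fun C hC => (hc hC).2.1, fun C hC => (hc hC).2.2.1,
    fun C hC => (hc hC).2.2.2.1, fun a ha b hb hab hdisj => ?_⟩
  by_contra hne
  have hd : 0 < dist (γ a) (γ b) := dist_pos.2 hne
  obtain ⟨δ, hδ, hu⟩ := Metric.uniformContinuousOn_iff.1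
    (isCompact_Icc.uniformContinuousOn_of_continuous hγ) _ (half_pos hd)
  set η := min δ ((b - a) / 3)
  have hη : 0 < η := lt_min hδ (by linarith)
  have hηδ : η ≤ δ := min_le_left _ _
  have hηab : η ≤ (b - a) / 3 := min_le_right _ _
  have : Nonempty c := ⟨⟨C₀, hC₀⟩⟩
  obtain ⟨⟨C, hC⟩, hCd⟩ := (isCompact_Icc (a := a + η) (b := b - η)).elim_directed_family_closed
    (fun C : c => (C : Set ℝ)) (fun C => (hc C.2).2.1) (by
      rw [← sInter_eq_iInter, ← disjoint_iff_inter_eq_empty]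
      exact hdisj.mono_left (Icc_subset_Ioo (by linarith) (by linarith)))
    (fun x y => by
      rcases hchain.total x.2 y.2 with h | h
      · exact ⟨x, subset_rfl, h⟩
      · exact ⟨y, h, subset_rfl⟩)
  obtain ⟨a', ha', b', hb', h1, h2, h3, h4, h5⟩ := exists_gap_of_disjoint
    (isCompact_Icc.of_isClosed_subset (hc hC).2.1 (hc hC).1) (ha C hC) (hb C hC)
    (show a < a + η by linarith) (show a + η ≤ b - η by linarith) (by linarith)
    (disjoint_iff_inter_eq_empty.2 hCd)
  have e1 := (hc hC).2.2.2.2 a' ha' b' hb' (by linarith) h5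
  have e2 := hu a (hsub ha) a' ((hc hC).1 ha')
    (by rw [Real.dist_eq, abs_sub_lt_iff]; constructor <;> linarith)
  have e3 := hu b' ((hc hC).1 hb') b (hsub hb)
    (by rw [Real.dist_eq, abs_sub_lt_iff]; constructor <;> linarith)
  rw [← e1] at e3
  linarith [dist_triangle (γ a) (γ a') (γ b)]

theorem exists_minimal_loopExcisions (hγ : ContinuousOn γ (Icc 0 1)) :
    ∃ C ∈ loopExcisions γ, ∀ s ∈ C, ∀ t ∈ C, s < t → γ s = γ t → Disjoint (Ioo s t) C := by
  obtain ⟨C, -, hC⟩ := zorn_superset_nonempty (loopExcisions γ)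
    (fun c hc hchain hne => ⟨⋂₀ c, sInter_mem_loopExcisions hγ hc hchain hne,
      fun s hs => sInter_subset_of_mem hs⟩) (Icc 0 1) ⟨subset_rfl, isClosed_Icc, by simp, by simp,
      fun a ha b hb hab hdisj => by
        obtain ⟨u, hu⟩ := exists_between hab
        exact absurd ⟨ha.1.trans hu.1.le, hu.2.le.trans hb.2⟩ (disjoint_left.1 hdisj hu)⟩
  obtain ⟨hsub, hcl, h0, h1, hgap⟩ := hC.prop
  refine ⟨C, hC.prop, fun s hs t ht hst hγst => ?_⟩
  have hmem : C \ Ioo s t ∈ loopExcisions γ := by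
    refine ⟨sdiff_subset.trans hsub, hcl.sdiff isOpen_Ioo, ⟨h0, fun h => ?_⟩, ⟨h1, fun h => ?_⟩,
      fun a ha b hb hab hdisj => ?_⟩
    · exact h.1.not_ge (hsub hs).1
    · exact h.2.not_ge (hsub ht).2
    · by_cases h : Disjoint (Ioo a b) C
      · exact hgap a ha.1 b hb.1 hab h
      · obtain ⟨u, hu, huC⟩ := not_disjoint_iff.1 h
        have hust : u ∈ Ioo s t := by
          by_contra hn
          exact disjoint_left.1 hdisj hu ⟨huC, hn⟩
        have has : a ≤ s := not_lt.1 fun hlt => ha.2 ⟨hlt, hu.1.trans hust.2⟩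
        have htb : t ≤ b := not_lt.1 fun hlt => hb.2 ⟨hust.1.trans hu.2, hlt⟩
        have hsa : s ≤ a := not_lt.1 fun hlt =>
          disjoint_left.1 hdisj ⟨hlt, hst.trans_le htb⟩ ⟨hs, fun h => h.1.false⟩
        have hbt : b ≤ t := not_lt.1 fun hlt =>
          disjoint_left.1 hdisj ⟨has.trans_lt hst, hlt⟩ ⟨ht, fun h => h.2.false⟩
        rw [has.antisymm hsa, ← htb.antisymm hbt, hγst]
  exact disjoint_left.2 fun u hu huC => (hC.le_of_le hmem sdiff_subset huC).2 hu

/-- A continuous function increasing strictly whenever the trace of `γ` along `C` grows. -/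
theorem exists_monotone_of_trace [TopologicalSpace.SeparableSpace α] {C : Set ℝ}
    (hC : IsCompact C) (hγ : ContinuousOn γ C) :
    ∃ h : ℝ → ℝ, ContinuousOn h C ∧ (∀ s ∈ C, ∀ t ∈ C, s ≤ t → h s ≤ h t) ∧
      (∀ s ∈ C, ∀ t ∈ C, s < t → γ t ∉ γ '' (C ∩ Iic s) → h s < h t) ∧
      ∀ s t, γ '' (C ∩ Iic s) = γ '' (C ∩ Iic t) → h s = h t := by
  have : Nonempty α := ⟨γ 0⟩
  let q := TopologicalSpace.denseSeq α
  let w : ℕ → ℝ → ℝ := fun n t => (1 / 2) ^ n * min 1 (Metric.infDist (q n) (γ '' (C ∩ Iic t)))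
  have hsum : Summable fun n : ℕ => ((1 : ℝ) / 2) ^ n := summable_geometric_two
  have hw0 : ∀ n t, 0 ≤ w n t := fun n t =>
    mul_nonneg (by positivity) (le_min zero_le_one Metric.infDist_nonneg)
  have hw1 : ∀ n t, w n t ≤ (1 / 2) ^ n := fun n t =>
    mul_le_of_le_one_right (by positivity) (min_le_left _ _)
  have hws : ∀ t, Summable fun n => w n t := fun t =>
    Summable.of_nonneg_of_le (fun n => hw0 n t) (fun n => hw1 n t) hsum
  have hwm : ∀ n, ∀ s ∈ C, ∀ t, s ≤ t → w n t ≤ w n s := fun n s hs t hst => by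
    have := Metric.infDist_le_infDist_of_subset (x := q n)
      (image_mono (f := γ) (inter_subset_inter_right C (Iic_subset_Iic.2 hst)))
      ⟨γ s, s, ⟨hs, self_mem_Iic⟩, rfl⟩
    simp only [w]
    gcongr
  have hinf : ∀ ε > 0, ∃ δ > 0, ∀ s ∈ C, ∀ t ∈ C, s ≤ t → t < s + δ → ∀ x,
      Metric.infDist x (γ '' (C ∩ Iic s)) ≤ Metric.infDist x (γ '' (C ∩ Iic t)) + ε := by
    intro ε hε
    obtain ⟨δ, hδ, hu⟩ := Metric.uniformContinuousOn_iff.1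
      (hC.uniformContinuousOn_of_continuous hγ) ε hε
    refine ⟨δ, hδ, fun s hs t ht hst htδ x => ?_⟩
    rw [← sub_le_iff_le_add]
    refine (Metric.le_infDist (s := γ '' (C ∩ Iic t)) ⟨γ t, t, ⟨ht, self_mem_Iic⟩, rfl⟩).2 ?_
    rintro _ ⟨u, ⟨huC, hut⟩, rfl⟩
    rcases le_total u s with h | h
    · linarith [Metric.infDist_le_dist_of_mem (x := x)
        (mem_image_of_mem γ (show u ∈ C ∩ Iic s from ⟨huC, h⟩))]
    · have h1 := hu u huC s hs (by
        rw [Real.dist_eq, abs_sub_lt_iff]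
        constructor <;> linarith [mem_Iic.1 hut])
      linarith [Metric.infDist_le_dist_of_mem (x := x)
        (mem_image_of_mem γ (show s ∈ C ∩ Iic s from ⟨hs, self_mem_Iic⟩)),
        dist_triangle x (γ u) (γ s)]
  have hinfc : ∀ x, ContinuousOn (fun t => Metric.infDist x (γ '' (C ∩ Iic t))) C := by
    intro x
    have hmono : ∀ s ∈ C, ∀ t, s ≤ t → Metric.infDist x (γ '' (C ∩ Iic t)) ≤
        Metric.infDist x (γ '' (C ∩ Iic s)) := fun s hs t hst =>
      Metric.infDist_le_infDist_of_subset
        (image_mono (f := γ) (inter_subset_inter_right C (Iic_subset_Iic.2 hst)))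
        ⟨γ s, s, ⟨hs, self_mem_Iic⟩, rfl⟩
    rw [Metric.continuousOn_iff]
    intro t ht ε hε
    obtain ⟨δ, hδ, hd⟩ := hinf (ε / 2) (half_pos hε)
    refine ⟨δ, hδ, fun s hs hst => ?_⟩
    rw [Real.dist_eq, abs_sub_lt_iff] at hst ⊢
    rcases le_total s t with h | h
    · have h1 := hd s hs t ht h (by linarith) x
      have h2 := hmono s hs t h
      constructor <;> linarith
    · have h1 := hd t ht s hs h (by linarith) x
      have h2 := hmono t ht s h
      constructor <;> linarith
  refine ⟨fun t => -∑' n, w n t, ?_, fun s hs t ht hst => ?_, fun s hs t ht hst hnot => ?_,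
    fun s t hst => by simp only [w, hst]⟩
  · refine (continuousOn_tsum (fun n => ?_) hsum fun n t _ => ?_).neg
    · exact continuousOn_const.mul (continuousOn_const.inf (hinfc _))
    · rw [Real.norm_of_nonneg (hw0 n t)]
      exact hw1 n t
  · exact neg_le_neg ((hws t).tsum_le_tsum (fun n => hwm n s hs t hst) (hws s))
  · have hcl : IsClosed (γ '' (C ∩ Iic s)) := ((hC.inter_right isClosed_Iic).image_of_continuousOn
      (hγ.mono inter_subset_left)).isClosed
    have hd := (hcl.notMem_iff_infDist_pos ⟨γ s, s, ⟨hs, self_mem_Iic⟩, rfl⟩).1 hnot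
    set d := Metric.infDist (γ t) (γ '' (C ∩ Iic s))
    obtain ⟨n, hn⟩ := Metric.denseRange_iff.1 (TopologicalSpace.denseRange_denseSeq α) (γ t)
      (min 1 d / 2) (half_pos (lt_min one_pos hd))
    refine neg_lt_neg ((hws t).tsum_lt_tsum (i := n) (fun n => hwm n s hs t hst.le) ?_ (hws s))
    have h1 : Metric.infDist (q n) (γ '' (C ∩ Iic t)) < min 1 d / 2 := by
      refine (Metric.infDist_le_dist_of_mem
        (mem_image_of_mem γ (show t ∈ C ∩ Iic t from ⟨ht, self_mem_Iic⟩))).trans_lt ?_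
      rwa [dist_comm]
    have h2 : d ≤ Metric.infDist (q n) (γ '' (C ∩ Iic s)) + dist (γ t) (q n) :=
      Metric.infDist_le_infDist_add_dist
    have h3 : min 1 d / 2 < min 1 (Metric.infDist (q n) (γ '' (C ∩ Iic s))) := by
      have := lt_min one_pos hd
      have h4 := min_le_left 1 d
      have h5 := min_le_right 1 d
      change dist (γ t) (q n) < _ at hn
      exact lt_min (by linarith) (by linarith)
    exact mul_lt_mul_of_pos_left ((min_le_right _ _).trans_lt (h1.trans h3)) (by positivity)

/-- The endpoints of a path are joined by an arc inside its image. -/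
theorem exists_isArcWithEndpoints_subset [TopologicalSpace.SeparableSpace α]
    (hγ : ContinuousOn γ (Icc 0 1)) (hne : γ 0 ≠ γ 1) :
    ∃ A ⊆ γ '' Icc 0 1, IsArcWithEndpoints A (γ 0) (γ 1) := by
  obtain ⟨C, ⟨hsub, hcl, hC0, hC1, hgap⟩, hmin⟩ := exists_minimal_loopExcisions hγ
  have hC : IsCompact C := isCompact_Icc.of_isClosed_subset hcl hsub
  obtain ⟨h, hc, hmono, hstrict, heq⟩ := exists_monotone_of_trace hC (hγ.mono hsub)
  have hlt : ∀ s ∈ C, ∀ t ∈ C, s < t → γ s ≠ γ t → h s < h t := by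
    intro s hs t ht hst hst'
    refine hstrict s hs t ht hst ?_
    rintro ⟨u, ⟨huC, hus⟩, hut⟩
    rcases (mem_Iic.1 hus).eq_or_lt with rfl | hus
    · exact hst' hut
    · exact disjoint_left.1 (hmin u huC t ht (hus.trans hst) hut) ⟨hus, hst⟩ hs
  have heqγ : ∀ s ∈ C, ∀ t ∈ C, h s = h t → γ s = γ t := by
    intro s hs t ht hst
    by_contra hn
    rcases lt_trichotomy s t with hlt' | rfl | hlt'
    · exact (hlt s hs t ht hlt' hn).ne hst
    · exact hn rfl
    · exact (hlt t ht s hs hlt' (Ne.symm hn)).ne' hst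
  have hgap' : ∀ s ∈ C, ∀ t ∈ C, s < t → Disjoint (Ioo s t) C → h s = h t := by
    intro s hs t ht hst hd
    refine heq s t (subset_antisymm
      (image_mono (inter_subset_inter_right C (Iic_subset_Iic.2 hst.le))) ?_)
    rintro _ ⟨u, ⟨huC, hut⟩, rfl⟩
    rcases le_or_gt u s with hus | hus
    · exact mem_image_of_mem γ ⟨huC, hus⟩
    · rcases (mem_Iic.1 hut).eq_or_lt with rfl | hut
      · rw [← hgap s hs u ht hst hd]
        exact mem_image_of_mem γ ⟨hs, self_mem_Iic⟩
      · exact absurd huC (disjoint_left.1 hd ⟨hus, hut⟩)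
  have heqh : ∀ s ∈ C, ∀ t ∈ C, γ s = γ t → h s = h t := by
    intro s hs t ht hst
    rcases lt_trichotomy s t with hlt' | rfl | hlt'
    · exact hgap' s hs t ht hlt' (hmin s hs t ht hlt' hst)
    · rfl
    · exact (hgap' t ht s hs hlt' (hmin t ht s hs hlt' hst.symm)).symm
  have hsurj : Icc (h 0) (h 1) ⊆ h '' C := by
    intro v hv
    obtain ⟨a, ⟨haC, hav⟩, hamax⟩ := (hC.of_isClosed_subset
      (hc.preimage_isClosed_of_isClosed hcl (isClosed_Iic (a := v)))
      inter_subset_left).exists_isGreatest ⟨0, hC0, hv.1⟩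
    obtain ⟨b, ⟨hbC, hbv⟩, hbmin⟩ := (hC.of_isClosed_subset
      (hc.preimage_isClosed_of_isClosed hcl (isClosed_Ici (a := v)))
      inter_subset_left).exists_isLeast ⟨1, hC1, hv.2⟩
    refine ⟨a, haC, le_antisymm hav ?_⟩
    rcases lt_or_ge a b with hab | hab
    · rw [hgap' a haC b hbC hab (disjoint_left.2 fun u hu huC => ?_)]
      · exact hbv
      · rcases le_total (h u) v with hle | hle
        · exact (hamax ⟨huC, hle⟩).not_gt hu.1
        · exact (hbmin ⟨huC, hle⟩).not_gt hu.2
    · exact (show v ≤ h b from hbv).trans (hmono b hbC a haC hab)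
  have h01 : h 0 < h 1 := hlt 0 hC0 1 hC1 one_pos hne
  let g : ℝ → α := γ ∘ Function.invFunOn h C
  have hg : EqOn (g ∘ h) γ C := fun t ht =>
    heqγ _ (Function.invFunOn_mem ⟨t, ht, rfl⟩) t ht (Function.invFunOn_eq ⟨t, ht, rfl⟩)
  have hgc : ContinuousOn g (h '' C) := hC.continuousOn_of_comp_eqOn hc (hγ.mono hsub) hg
  have hmaps : MapsTo (fun r => h 0 + r * (h 1 - h 0)) (Icc 0 1) (h '' C) := by
    intro r hr
    refine hsurj ⟨?_, ?_⟩ <;> nlinarith [hr.1, hr.2]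
  refine ⟨(fun r => g (h 0 + r * (h 1 - h 0))) '' Icc 0 1, ?_,
    fun r => g (h 0 + r * (h 1 - h 0)), hgc.comp (by fun_prop) hmaps, ?_, rfl, ?_, ?_⟩
  · rintro _ ⟨r, hr, rfl⟩
    exact mem_image_of_mem γ (hsub (Function.invFunOn_mem (hmaps hr)))
  · intro r hr r' hr' hrr
    have := heqh _ (Function.invFunOn_mem (hmaps hr)) _ (Function.invFunOn_mem (hmaps hr')) hrr
    rw [Function.invFunOn_eq (hmaps hr), Function.invFunOn_eq (hmaps hr')] at this
    exact mul_right_cancel₀ (sub_pos.2 h01).ne' (add_left_cancel this)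
  · simpa using hg hC0
  · simpa using hg hC1

end ArcOfPath

/-- Concatenation of infinitely many paths converging to a point. -/
theorem exists_continuousOn_of_joinedIn {α : Type*} [MetricSpace α] {e : α} {x : ℕ → α}
    {V : ℕ → Set α} (hV : ∀ n, JoinedIn (V n) (x n) (x (n + 1)))
    (he : ∀ ε > 0, ∃ N, ∀ n ≥ N, V n ⊆ Metric.ball e ε) :
    ∃ γ : ℝ → α, ContinuousOn γ (Icc 0 1) ∧ γ 0 = e ∧ ∀ t ∈ Ioc (0 : ℝ) 1, ∃ n, γ t ∈ V n := by
  let P : ∀ n, Path (x n) (x (n + 1)) := fun n => (hV n).somePath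
  let Γ : ℝ → α := fun t => (P ⌊t⌋₊).extend (t - ⌊t⌋₊)
  have hΓV : ∀ t, Γ t ∈ V ⌊t⌋₊ := fun t => by
    have := (hV ⌊t⌋₊).somePath_mem (projIcc 0 1 zero_le_one (t - ⌊t⌋₊))
    exact this
  have hΓn : ∀ n : ℕ, ContinuousOn Γ (Icc n (n + 1)) := by
    intro n
    have hcont : Continuous fun t : ℝ => (P n).extend (t - n) := by fun_prop
    refine hcont.continuousOn.congr fun t ht => ?_
    rcases ht.2.eq_or_lt with rfl | hlt
    · have : ⌊(n : ℝ) + 1⌋₊ = n + 1 := by exact_mod_cast Nat.floor_natCast (R := ℝ) (n + 1)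
      simp [Γ, this]
    · have : ⌊t⌋₊ = n := (Nat.floor_eq_iff (n.cast_nonneg.trans ht.1)).2 ⟨ht.1, hlt⟩
      subst this
      rfl
  have hΓN : ∀ N : ℕ, ContinuousOn Γ (Icc 0 N) := by
    intro N
    induction N with
    | zero => simp
    | succ N ih =>
      rw [Nat.cast_succ, ← Icc_union_Icc_eq_Icc N.cast_nonneg (by linarith : (N : ℝ) ≤ N + 1)]
      exact ih.union_of_isClosed (hΓn N) isClosed_Icc isClosed_Icc
  have hΓ : ContinuousOn Γ (Ici 0) := by
    intro t ht
    obtain ⟨N, hN⟩ := exists_nat_gt t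
    refine (hΓN N t ⟨ht, hN.le⟩).mono_of_mem_nhdsWithin ?_
    filter_upwards [self_mem_nhdsWithin, mem_nhdsWithin_of_mem_nhds (Iio_mem_nhds hN)] with u h1 h2
    exact ⟨h1, h2.le⟩
  have hpos : ∀ t ∈ Ioc (0 : ℝ) 1, t⁻¹ - 1 ∈ Ici (0 : ℝ) := fun t ht =>
    sub_nonneg.2 ((one_le_inv₀ ht.1).2 ht.2)
  refine ⟨fun t => if t ≤ 0 then e else Γ (t⁻¹ - 1), ?_, by simp, fun t ht =>
    ⟨⌊t⁻¹ - 1⌋₊, by simpa only [if_neg ht.1.not_ge] using hΓV _⟩⟩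
  intro t ht
  rcases ht.1.eq_or_lt with rfl | h0
  · rw [Metric.continuousWithinAt_iff]
    intro ε hε
    obtain ⟨N, hN⟩ := he ε hε
    refine ⟨(N + 1 : ℝ)⁻¹, by positivity, fun u hu hdist => ?_⟩
    rw [if_pos le_rfl]
    split_ifs with hu0
    · simpa using hε
    · rw [not_le] at hu0
      refine hN _ (Nat.le_floor ?_) (hΓV _)
      rw [Real.dist_eq, sub_zero, abs_of_pos hu0] at hdist
      linarith [(lt_inv_comm₀ hu0 (by positivity)).1 hdist]
  · have hc : ContinuousOn (fun t : ℝ => Γ (t⁻¹ - 1)) (Ioc 0 1) :=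
      hΓ.comp ((continuousOn_id.inv₀ fun u hu => hu.1.ne').sub continuousOn_const) hpos
    refine ((hc t ⟨h0, ht.2⟩).congr (fun u hu => if_neg hu.1.not_ge)
      (if_neg h0.not_ge)).mono_of_mem_nhdsWithin ?_
    filter_upwards [self_mem_nhdsWithin, mem_nhdsWithin_of_mem_nhds (Ioi_mem_nhds h0)] with u h1 h2
    exact ⟨h2, h1.2⟩

theorem exists_joinedIn_ball_diff_plane {X M : Set Plane} (hX : IsCompact X)
    (hlog : ∀ f : Plane → ℂ, ContinuousOn f X → (∀ z ∈ X, f z ≠ 0) → HasLogOn f X)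
    (hM : IsClosed M) (hMX : M ⊆ X) (hMc : IsPreconnected M) {e : Plane} {ε : ℝ} (hε : 0 < ε)
    (heM : e ∉ M) (hXM : X \ Metric.ball e ε ⊆ M) :
    ∃ δ > 0, ∀ x ∈ Metric.ball e δ \ X, ∀ y ∈ Metric.ball e δ \ X,
      JoinedIn (Metric.ball e ε \ X) x y := by
  let φ : ℂ ≃ₗᵢ[ℝ] Plane := Complex.orthonormalBasisOneI.repr
  have hφ : Continuous φ := φ.continuous
  have hφs : Continuous φ.symm := φ.symm.continuous
  have himg : ∀ S : Set Plane, φ.symm '' S = φ ⁻¹' S := fun S =>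
    φ.symm.toEquiv.image_eq_preimage_symm S
  have hball : ∀ r, φ ⁻¹' Metric.ball e r = Metric.ball (φ.symm e) r := fun r => by
    rw [← himg]
    exact φ.symm.image_ball e r
  have hlog' : ∀ f : ℂ → ℂ, ContinuousOn f (φ ⁻¹' X) → (∀ z ∈ φ ⁻¹' X, f z ≠ 0) →
      HasLogOn f (φ ⁻¹' X) := by
    intro f hf hne
    obtain ⟨L, hL, hLe⟩ := hlog (f ∘ φ.symm)
      (hf.comp hφs.continuousOn fun z hz => by simpa using hz)
      fun z hz => hne _ (by simpa using hz)
    exact ⟨L ∘ φ, hL.comp hφ.continuousOn fun z hz => hz, fun z hz => by simpa using hLe (φ z) hz⟩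
  obtain ⟨δ, hδ, h⟩ := exists_joinedIn_ball_diff (X := φ ⁻¹' X) (M := φ ⁻¹' M) (e := φ.symm e)
    (himg X ▸ hX.image hφs) hlog' (hM.preimage hφ) (preimage_mono hMX)
    (himg M ▸ hMc.image _ hφs.continuousOn) hε (by simpa using heM)
    (by rw [← hball]; exact preimage_mono hXM)
  refine ⟨δ, hδ, fun x hx y hy => ?_⟩
  have hx' : φ.symm x ∈ Metric.ball (φ.symm e) δ \ φ ⁻¹' X := by
    rw [← hball]; simpa using hx
  have hy' : φ.symm y ∈ Metric.ball (φ.symm e) δ \ φ ⁻¹' X := by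
    rw [← hball]; simpa using hy
  have := (h _ hx' _ hy').map_continuousOn (f := φ) hφ.continuousOn
  rw [φ.apply_symm_apply, φ.apply_symm_apply, ← hball] at this
  exact this.mono (image_preimage_subset φ (Metric.ball e ε \ X))

/-- Corollary: endpoints of smooth plane dendroids are accessible. -/
theorem stmt_4 (X : Set Plane) (p : Plane) (hX : IsDendroid X) (hp : DendroidSmoothAt X p) :
    ∀ e ∈ Endpoints X \ {p}, AccessiblePoint X e := by
  rintro e ⟨he, hep⟩
  obtain ⟨hcomp, -, huni, -⟩ := hX
  obtain ⟨hpX, arcTo, hpp, harc, hs⟩ := hp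
  have hjoin : ∀ n : ℕ, ∃ δ > 0, ∀ x ∈ Metric.ball e δ \ X, ∀ y ∈ Metric.ball e δ \ X,
      JoinedIn (Metric.ball e (1 / (n + 1)) \ X) x y := by
    intro n
    obtain ⟨M, hMX, hM, hMc, heM, hXM⟩ := exists_colocal_subcontinuum hcomp hs hpp harc he hep
      (ε := 1 / (n + 1)) (by positivity)
    exact exists_joinedIn_ball_diff_plane hcomp
      (fun f hf hne => hasLogOn_of_arcTo hs hpX hpp harc hf hne) hM hMX hMc (by positivity) heM hXM
  choose δ hδ hj using hjoin
  have hx : ∀ n : ℕ, ∃ x, x ∉ X ∧ ∀ k ≤ n, x ∈ Metric.ball e (δ k) := by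
    intro n
    have hmem : (⋂ k ∈ Iic n, Metric.ball e (δ k)) ∈ 𝓝 e :=
      (biInter_mem (finite_Iic n)).2 fun k _ => Metric.ball_mem_nhds e (hδ k)
    obtain ⟨r, hr, hrs⟩ := Metric.mem_nhds_iff.1 hmem
    obtain ⟨x, hxr, hxX⟩ := not_subset.1 (huni.not_ball_subset e hr)
    exact ⟨x, hxX, fun k hk => mem_iInter₂.1 (hrs hxr) k hk⟩
  choose x hxX hxδ using hx
  obtain ⟨γ, hγ, hγ0, hγV⟩ := exists_continuousOn_of_joinedIn (e := e) (x := x)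
    (fun n => hj n _ ⟨hxδ n n le_rfl, hxX n⟩ _ ⟨hxδ (n + 1) n n.le_succ, hxX (n + 1)⟩) (by
      intro ε hε
      obtain ⟨N, hN⟩ := exists_nat_one_div_lt hε
      refine ⟨N, fun n hn => sdiff_subset.trans (Metric.ball_subset_ball (le_trans ?_ hN.le))⟩
      exact one_div_le_one_div_of_le (by positivity) (by gcongr))
  have hγX : ∀ t ∈ Ioc (0 : ℝ) 1, γ t ∉ X := fun t ht => (hγV t ht).elim fun n hn => hn.2
  have hne : γ 0 ≠ γ 1 := fun h => hγX 1 (by simp) (h ▸ hγ0.symm ▸ he.1)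
  obtain ⟨A, hA, harcA⟩ := exists_isArcWithEndpoints_subset hγ hne
  refine ⟨A, ⟨_, _, harcA⟩, subset_antisymm ?_ ?_⟩
  · rintro z ⟨hzA, hzX⟩
    obtain ⟨t, ht, rfl⟩ := hA hzA
    rcases ht.1.eq_or_lt with rfl | h0
    · exact hγ0
    · exact absurd hzX (hγX t ⟨h0, ht.2⟩)
  · rintro z rfl
    exact ⟨hγ0 ▸ harcA.left_mem, he.1⟩
end

section
/- Let O be a simple closed curve in the plane with complementary components U and V, and let a, b, c, d ∈ O in cyclic order. Let α be an arc in cl(U) \ {b,d} from a to c and β an arc in cl(V) \ {b,d} from a to c. Then α ∪ β contains a simple closed curve σ which separates b from d in the plane. -/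
open Set Filter Topology

/-- Two continuous logarithms of the same function on a preconnected set differ by a constant. -/
theorem exists_eq_add_of_exp_eq {X : Type*} [TopologicalSpace X] {S : Set X}
    (hS : IsPreconnected S) {g₁ g₂ : X → ℂ} (h₁ : ContinuousOn g₁ S) (h₂ : ContinuousOn g₂ S)
    (h : ∀ x ∈ S, Complex.exp (g₁ x) = Complex.exp (g₂ x)) :
    ∃ k : ℂ, Complex.exp k = 1 ∧ ∀ x ∈ S, g₁ x = g₂ x + k := by
  have hpi : (2 * Real.pi * Complex.I : ℂ) ≠ 0 := Complex.two_pi_I_ne_zero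
  rcases S.eq_empty_or_nonempty with rfl | ⟨x₀, hx₀⟩
  · exact ⟨0, by simp, by simp⟩
  have hint : ∀ x ∈ S, ∃ n : ℤ, g₁ x = g₂ x + n * (2 * Real.pi * Complex.I) := fun x hx =>
    Complex.exp_eq_exp_iff_exists_int.1 (h x hx)
  have hc : ContinuousOn (fun x => (g₁ x - g₂ x) / (2 * Real.pi * Complex.I)) S :=
    (h₁.sub h₂).div_const _
  have hr : ContinuousOn (fun x => ((g₁ x - g₂ x) / (2 * Real.pi * Complex.I)).re) S :=
    Complex.continuous_re.comp_continuousOn hc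
  have hval : ∀ x ∈ S, ∃ n : ℤ, (g₁ x - g₂ x) / (2 * Real.pi * Complex.I) = n := by
    intro x hx
    obtain ⟨n, hn⟩ := hint x hx
    exact ⟨n, by rw [hn]; field_simp; ring⟩
  have hT : IsDiscrete (range ((↑) : ℤ → ℝ)) :=
    isDiscrete_iff_discreteTopology.2
      Int.isClosedEmbedding_coe_real.isEmbedding.toHomeomorph.symm.isEmbedding.discreteTopology
  have hmaps : MapsTo (fun x => ((g₁ x - g₂ x) / (2 * Real.pi * Complex.I)).re) S
      (range ((↑) : ℤ → ℝ)) := by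
    intro x hx
    obtain ⟨n, hn⟩ := hval x hx
    exact ⟨n, by simp [hn]⟩
  refine ⟨g₁ x₀ - g₂ x₀, ?_, fun x hx => ?_⟩
  · rw [Complex.exp_sub, h x₀ hx₀, div_self (Complex.exp_ne_zero _)]
  · obtain ⟨n, hn⟩ := hval x hx
    obtain ⟨m, hm⟩ := hval x₀ hx₀
    have := hS.constant_of_mapsTo hT hr hmaps hx hx₀
    simp only [hn, hm, Complex.intCast_re, Int.cast_inj] at this
    subst this
    rw [← hm, div_left_inj' hpi] at hn
    linear_combination hn

/-- There is no continuous logarithm of `c * (z - b)` on a circle centred at `b`. -/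
theorem not_exp_eq_mul_sub_on_sphere {b c : ℂ} {r : ℝ} (hr : 0 ≤ r) {g : ℂ → ℂ}
    (hg : ContinuousOn g (Metric.sphere b r))
    (h : ∀ z ∈ Metric.sphere b r, Complex.exp (g z) = c * (z - b)) : False := by
  have hmem : ∀ θ : ℝ, circleMap b r θ ∈ Metric.sphere b r := circleMap_mem_sphere b hr
  have hcont : Continuous fun θ : ℝ => g (circleMap b r θ) :=
    hg.comp_continuous (continuous_circleMap b r) hmem
  obtain ⟨k, -, hk⟩ := exists_eq_add_of_exp_eq (S := (univ : Set ℝ)) isPreconnected_univ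
    (g₁ := fun θ : ℝ => g (circleMap b r θ)) (g₂ := fun θ : ℝ => g (circleMap b r 0) + θ * Complex.I)
    hcont.continuousOn (by fun_prop) (by
      intro θ _
      rw [Complex.exp_add, h _ (hmem _), h _ (hmem _)]
      simp [circleMap]
      ring)
  have h0 := hk 0 (mem_univ _)
  have h1 := hk (2 * Real.pi) (mem_univ _)
  have hp : circleMap b r (2 * Real.pi) = circleMap b r 0 := by simp [circleMap]
  simp only [hp] at h1
  apply Complex.two_pi_I_ne_zero
  push_cast at h0 h1
  linear_combination h0 - h1

/-- If `x` and `y` lie in a preconnected subset of the complement of a closed set `F`, then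
`(z - x) / (z - y)` has a continuous logarithm on `F`. -/
theorem exists_log_of_isPreconnected {F K : Set ℂ} (hF : IsClosed F) (hK : IsPreconnected K)
    (hKF : K ⊆ Fᶜ) {x y : ℂ} (hx : x ∈ K) (hy : y ∈ K) :
    ∃ g : ℂ → ℂ, ContinuousOn g F ∧ ∀ z ∈ F, Complex.exp (g z) = (z - x) / (z - y) := by
  have hne : ∀ w ∈ K, ∀ z ∈ F, z - w ≠ 0 := fun w hw z hz h =>
    hKF hw (by rwa [← sub_eq_zero.1 h])
  refine hK.induction₂ (fun x y => ∃ g : ℂ → ℂ, ContinuousOn g F ∧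
    ∀ z ∈ F, Complex.exp (g z) = (z - x) / (z - y)) ?_ ?_ ?_ hx hy
  · intro x hx
    obtain ⟨ε, hε, hball⟩ := Metric.isOpen_iff.1 hF.isOpen_compl x (hKF hx)
    have hev : ∀ᶠ y in 𝓝[K] x, y ∈ K ∧ dist y x < ε / 2 :=
      eventually_mem_nhdsWithin.and
        (mem_nhdsWithin_of_mem_nhds (Metric.ball_mem_nhds x (half_pos hε)))
    filter_upwards [hev] with y ⟨hyK, hy⟩
    have hslit : ∀ z ∈ F, (z - x) / (z - y) ∈ Complex.slitPlane := by
      intro z hz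
      have hzx : ε ≤ dist z x := by
        by_contra! hlt
        exact hball hlt hz
      have hzy : ε / 2 < dist z y := by
        have := dist_triangle z y x
        linarith
      have heq : (z - x) / (z - y) = 1 + (y - x) / (z - y) := by
        have := hne y hyK z hz
        field_simp
        ring
      rw [heq]
      apply Complex.mem_slitPlane_of_norm_lt_one
      rw [dist_eq_norm] at hy hzy
      rw [norm_div, div_lt_one (by linarith)]
      linarith
    refine ⟨fun z => Complex.log ((z - x) / (z - y)), ?_, fun z hz => ?_⟩
    · refine ContinuousOn.clog (ContinuousOn.div (by fun_prop) (by fun_prop) (hne y hyK)) hslit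
    · exact Complex.exp_log (Complex.slitPlane_ne_zero (hslit z hz))
  · rintro x y w hx hy hw ⟨g₁, hg₁, h₁⟩ ⟨g₂, hg₂, h₂⟩
    refine ⟨fun z => g₁ z + g₂ z, hg₁.add hg₂, fun z hz => ?_⟩
    rw [Complex.exp_add, h₁ z hz, h₂ z hz]
    have := hne y hy z hz
    have := hne w hw z hz
    field_simp
  · rintro x y hx hy ⟨g, hg, h⟩
    refine ⟨fun z => -g z, hg.neg, fun z hz => ?_⟩
    rw [Complex.exp_neg, h z hz, inv_div]

/-- A nowhere zero continuous function on a simply connected space has a continuous logarithm. -/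
theorem exists_log_of_simplyConnected {X : Type*} [TopologicalSpace X] [SimplyConnectedSpace X]
    [LocallyPathConnectedSpace X] {h : X → ℂ} (hc : Continuous h) (h0 : ∀ x, h x ≠ 0) :
    ∃ g : X → ℂ, Continuous g ∧ ∀ x, Complex.exp (g x) = h x := by
  obtain ⟨x₀⟩ : Nonempty X := inferInstance
  obtain ⟨F, ⟨-, hF⟩, -⟩ := Complex.isCoveringMapOn_exp.existsUnique_continuousMap_lifts
    (⟨h, hc⟩ : C(X, ℂ)) (a₀ := x₀) (e₀ := Complex.log (h x₀)) (Complex.exp_log (h0 x₀)) h0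
  exact ⟨F, F.continuous, fun x => congrFun hF x⟩

/-- An arc in the plane does not contain the frontier of a bounded set `W` having
points in its interior and exterior. -/
theorem false_of_frontier_subset_arc {f : ℝ → ℂ} (hf : Continuous f) {s t : ℝ} (hst : s ≤ t)
    (hinj : InjOn f (Icc s t)) {W : Set ℂ} (hWb : Bornology.IsBounded W)
    (hWJ : frontier W ⊆ f '' Icc s t) {u v : ℂ} (hu : u ∈ W) (hv : v ∉ W)
    (huJ : u ∉ f '' Icc s t) (hvJ : v ∉ f '' Icc s t) : False := by
  obtain ⟨g, hg, hge⟩ := exists_log_of_simplyConnected (X := ℝ)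
    (h := fun x => (f (projIcc s t hst x) - u) / (f (projIcc s t hst x) - v))
    (by
      refine Continuous.div (by fun_prop) (by fun_prop) fun x h => hvJ ?_
      exact ⟨_, (projIcc s t hst x).2, sub_eq_zero.1 h⟩)
    (fun x => div_ne_zero
      (fun h => huJ ⟨_, (projIcc s t hst x).2, sub_eq_zero.1 h⟩)
      (fun h => hvJ ⟨_, (projIcc s t hst x).2, sub_eq_zero.1 h⟩))
  have hemb : IsClosedEmbedding fun x : Icc s t => f x :=
    (hf.comp continuous_subtype_val).isClosedEmbedding hinj.injective
  obtain ⟨G, hG⟩ := ContinuousMap.exists_extension hemb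
    (⟨fun x : Icc s t => g x, by fun_prop⟩ : C(Icc s t, ℂ))
  have hGJ : ∀ z ∈ f '' Icc s t, Complex.exp (G z) = (z - u) / (z - v) := by
    rintro _ ⟨x, hx, rfl⟩
    have h1 : G (f x) = g x := DFunLike.congr_fun hG ⟨x, hx⟩
    rw [h1, hge, projIcc_of_mem hst hx]
  classical
  obtain ⟨L, hL, hLe⟩ := exists_log_of_simplyConnected (X := ℂ)
    (h := fun z => if z ∈ W then (z - v) * Complex.exp (G z) else z - u)
    (by
      refine Continuous.if (fun z hz => ?_) (by fun_prop) (by fun_prop)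
      have hzJ := hWJ hz
      have : z - v ≠ 0 := fun h => hvJ (by rwa [← sub_eq_zero.1 h])
      rw [hGJ z hzJ]
      field_simp)
    (fun z => by
      split_ifs with hz
      · exact mul_ne_zero (fun h => hv (by rwa [← sub_eq_zero.1 h])) (Complex.exp_ne_zero _)
      · exact fun h => hz (by rwa [sub_eq_zero.1 h]))
  obtain ⟨r, hr0, hr⟩ := hWb.subset_ball_lt 0 u
  refine not_exp_eq_mul_sub_on_sphere (b := u) (c := 1) hr0.le hL.continuousOn fun z hz => ?_
  have hzW : z ∉ W := fun h => by
    have h1 := Metric.mem_ball.1 (hr h)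
    rw [Metric.mem_sphere.1 hz] at h1
    exact lt_irrefl _ h1
  rw [hLe, if_neg hzW, one_mul]

theorem exists_int_of_periodic_of_injOn {X : Type*} {f : ℝ → X} (hper : Function.Periodic f 1)
    (hinj : InjOn f (Ico 0 1)) {s t : ℝ} (h : f s = f t) : ∃ n : ℤ, s = t + n := by
  have hfr : ∀ x, f (Int.fract x) = f x := fun x => by
    rw [Int.fract]
    simpa using hper.sub_int_mul_eq (x := x) ⌊x⌋
  have := hinj ⟨Int.fract_nonneg s, Int.fract_lt_one s⟩ ⟨Int.fract_nonneg t, Int.fract_lt_one t⟩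
    (by rw [hfr, hfr, h])
  obtain ⟨n, hn⟩ := Int.fract_eq_fract.1 this
  exact ⟨n, by linarith⟩

theorem injOn_of_periodic_of_injOn {X : Type*} {f : ℝ → X} (hper : Function.Periodic f 1)
    (hinj : InjOn f (Ico 0 1)) {S : Set ℝ} (hS : ∀ x ∈ S, ∀ y ∈ S, x - y < 1) : InjOn f S := by
  intro x hx y hy h
  obtain ⟨n, hn⟩ := exists_int_of_periodic_of_injOn hper hinj h
  have h1 := hS x hx y hy
  have h2 := hS y hy x hx
  have h3 : n < 1 := by exact_mod_cast (by linarith : (n : ℝ) < 1)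
  have h4 : -1 < n := by exact_mod_cast (by push_cast; linarith : ((-1 : ℤ) : ℝ) < n)
  obtain rfl : n = 0 := by omega
  simpa using hn

/-- If a closed set `C` misses a point of a simple closed curve, then `C` meets the curve
inside an arc. -/
theorem exists_arc_of_notMem {f : ℝ → ℂ} (hf : Continuous f) (hper : Function.Periodic f 1)
    (hinj : InjOn f (Ico 0 1)) {C : Set ℂ} (hC : IsClosed C) {t₀ : ℝ} (ht₀ : f t₀ ∉ C) :
    ∃ s t, s ≤ t ∧ InjOn f (Icc s t) ∧ range f ∩ C ⊆ f '' Icc s t := by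
  obtain ⟨δ, hδ, hball⟩ := Metric.isOpen_iff.1 (hC.isOpen_compl.preimage hf) t₀ ht₀
  set η := min (δ / 2) (1 / 4) with hη
  have hη0 : 0 < η := lt_min (by linarith) (by norm_num)
  have hη1 : η ≤ 1 / 4 := min_le_right _ _
  have hηδ : η < δ := lt_of_le_of_lt (min_le_left _ _) (by linarith)
  refine ⟨t₀ + η, t₀ + 1 - η, by linarith, injOn_of_periodic_of_injOn hper hinj ?_, ?_⟩
  · rintro x ⟨hx, hx'⟩ y ⟨hy, hy'⟩
    linarith
  · rintro _ ⟨⟨x, rfl⟩, hxC⟩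
    obtain ⟨y, ⟨hy1, hy2⟩, hxy⟩ := hper.exists_mem_Ico one_pos x (t₀ - η)
    rw [hxy] at hxC ⊢
    by_contra hcon
    have hy3 : y < t₀ + η := by
      by_contra! hlt
      exact hcon ⟨y, ⟨hlt, by linarith⟩, rfl⟩
    exact hball (show y ∈ Metric.ball t₀ δ by
      rw [Metric.mem_ball, Real.dist_eq, abs_lt]; constructor <;> linarith) hxC

theorem closure_subset_union_of_isOpen {X : Type*} [TopologicalSpace X] {O U V : Set X}
    (hUV : Oᶜ = U ∪ V) (hdisj : Disjoint U V) (hV : IsOpen V) : closure U ⊆ U ∪ O := by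
  have h : U ⊆ Vᶜ := hdisj.subset_compl_right
  intro z hz
  have hzV : z ∉ V := closure_minimal h hV.isClosed_compl hz
  by_contra hcon
  rw [mem_union, not_or] at hcon
  have : z ∈ U ∪ V := hUV ▸ hcon.2
  exact this.elim hcon.1 hzV

/-- Each point of a simple closed curve is in the closure of the bounded complementary domain. -/
theorem mem_closure_of_isBounded {f : ℝ → ℂ} (hf : Continuous f) (hper : Function.Periodic f 1)
    (hinj : InjOn f (Ico 0 1)) {U V : Set ℂ} (hUV : (range f)ᶜ = U ∪ V) (hdisj : Disjoint U V)
    (hU : IsOpen U) (hV : IsOpen V) (hUne : U.Nonempty) (hVne : V.Nonempty)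
    (hUb : Bornology.IsBounded U) (t : ℝ) : f t ∈ closure U := by
  by_contra hcon
  obtain ⟨s, t, hst, hI, hsub⟩ := exists_arc_of_notMem hf hper hinj isClosed_closure hcon
  obtain ⟨u, hu⟩ := hUne
  obtain ⟨v, hv⟩ := hVne
  have hnot : ∀ z ∈ U ∪ V, z ∉ f '' Icc s t := fun z hz h =>
    (hUV ▸ hz : z ∈ (range f)ᶜ) (image_subset_range _ _ h)
  refine false_of_frontier_subset_arc hf hst hI hUb (fun z hz => ?_) hu
    (fun h => hdisj.ne_of_mem h hv rfl) (hnot u (Or.inl hu)) (hnot v (Or.inr hv))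
  rw [hU.frontier_eq] at hz
  exact hsub ⟨(closure_subset_union_of_isOpen hUV hdisj hV hz.1).resolve_left hz.2, hz.1⟩

/-- Each point of a simple closed curve is in the closure of the other complementary domain. -/
theorem mem_closure_of_isBounded_compl {f : ℝ → ℂ} (hf : Continuous f)
    (hper : Function.Periodic f 1)
    (hinj : InjOn f (Ico 0 1)) {U V : Set ℂ} (hUV : (range f)ᶜ = U ∪ V) (hdisj : Disjoint U V)
    (hU : IsOpen U) (hV : IsOpen V) (hUne : U.Nonempty) (hVne : V.Nonempty)
    (hUb : Bornology.IsBounded U) (t : ℝ) : f t ∈ closure V := by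
  by_contra hcon
  obtain ⟨s, t, hst, hI, hsub⟩ := exists_arc_of_notMem hf hper hinj isClosed_closure hcon
  obtain ⟨u, hu⟩ := hUne
  obtain ⟨v, hv⟩ := hVne
  have hnot : ∀ z ∈ U ∪ V, z ∉ f '' Icc s t := fun z hz h =>
    (hUV ▸ hz : z ∈ (range f)ᶜ) (image_subset_range _ _ h)
  have huV : u ∉ V := fun h => hdisj.ne_of_mem hu h rfl
  have hJ : IsClosed (f '' Icc s t) := (isCompact_Icc.image hf).isClosed
  have hUV' : (range f)ᶜ = V ∪ U := by rw [hUV, union_comm]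
  have hcl := closure_subset_union_of_isOpen hUV' hdisj.symm hU
  have heq : V ∪ f '' Icc s t = closure V ∪ f '' Icc s t := by
    refine subset_antisymm (union_subset_union_left _ subset_closure) (union_subset ?_
      subset_union_right)
    intro z hz
    exact (hcl hz).imp id fun h => hsub ⟨h, hz⟩
  have hopen : IsOpen (V ∪ f '' Icc s t)ᶜ := by
    rw [heq]
    exact (isClosed_closure.union hJ).isOpen_compl
  have hO : Bornology.IsBounded (range f) :=
    (hper.compact_of_continuous one_ne_zero hf).isBounded
  refine false_of_frontier_subset_arc hf hst hI (W := (V ∪ f '' Icc s t)ᶜ) (u := u) (v := v)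
    ((hUb.union hO).subset ?_) (fun z hz => ?_) ?_ (fun h => h (Or.inl hv))
    (hnot u (Or.inl hu)) (hnot v (Or.inr hv))
  · intro z hz
    by_cases hzO : z ∈ range f
    · exact Or.inr hzO
    · have : z ∈ U ∪ V := hUV ▸ hzO
      exact Or.inl (this.resolve_right fun h => hz (Or.inl h))
  · rw [hopen.frontier_eq] at hz
    have hzV : z ∈ Vᶜ := closure_minimal
      (compl_subset_compl.2 subset_union_left) hV.isClosed_compl hz.1
    exact (not_not.1 hz.2).resolve_left hzV
  · rintro (h | h)
    · exact huV h
    · exact hnot u (Or.inl hu) h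

/-- Let `U` and `V` be the complementary domains of a simple closed curve. The union of a
connected set in the closure of `U` and one in the closure of `V` separates two points `b`, `d`
of the curve if both sets meet the two arcs into which `b` and `d` divide the curve in common
points. -/
theorem separation_of_crosscuts {f : ℝ → ℂ} (hf : Continuous f) (hper : Function.Periodic f 1)
    (hinj : InjOn f (Ico 0 1)) {U V : Set ℂ} (hUV : (range f)ᶜ = U ∪ V) (hdisj : Disjoint U V)
    (hU : IsOpen U) (hV : IsOpen V) (hUc : IsConnected U) (hVc : IsConnected V)
    (hUb : Bornology.IsBounded U) {tb td tp tq : ℝ} (h1 : td - 1 < tp) (h2 : tp < tb)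
    (h3 : tb < tq) (h4 : tq < td) {A B : Set ℂ} (hA : IsPreconnected A) (hB : IsPreconnected B)
    (hAc : IsClosed A) (hBc : IsClosed B) (hAU : A ⊆ closure U)
    (hBV : B ⊆ closure V) (hpA : f tp ∈ A) (hqA : f tq ∈ A) (hpB : f tp ∈ B)
    (hqB : f tq ∈ B) {K : Set ℂ} (hK : IsPreconnected K) (hKAB : K ⊆ (A ∪ B)ᶜ)
    (hbK : f tb ∈ K) (hdK : f td ∈ K) : False := by
  have hbU := mem_closure_of_isBounded hf hper hinj hUV hdisj hU hV hUc.1 hVc.1 hUb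
  have hbV := mem_closure_of_isBounded_compl hf hper hinj hUV hdisj hU hV hUc.1 hVc.1 hUb
  set b := f tb with hb
  set d := f td with hd
  have hbd : b ≠ d := by
    intro h
    have := injOn_of_periodic_of_injOn hper hinj (S := Icc tb td)
      (by rintro x ⟨hx, hx'⟩ y ⟨hy, hy'⟩; linarith) ⟨le_rfl, by linarith⟩ ⟨by linarith, le_rfl⟩ h
    linarith
  obtain ⟨ε₁, hε₁, hball₁⟩ := Metric.isOpen_iff.1 (hAc.union hBc).isOpen_compl b (hKAB hbK)
  obtain ⟨ε₂, hε₂, hball₂⟩ := Metric.isOpen_iff.1 (hAc.union hBc).isOpen_compl d (hKAB hdK)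
  have hD : 0 < dist b d := dist_pos.2 hbd
  obtain ⟨ε, hε, hεl⟩ : ∃ ε > 0, ε ≤ ε₁ ∧ ε ≤ ε₂ ∧ 2 * ε ≤ dist b d :=
    ⟨min (min ε₁ ε₂) (dist b d / 2), by positivity, (min_le_left _ _).trans (min_le_left _ _),
      (min_le_left _ _).trans (min_le_right _ _), by
        have := min_le_right (min ε₁ ε₂) (dist b d / 2); linarith⟩
  obtain ⟨hεε₁, hεε₂, hεd⟩ := hεl
  set N := Metric.ball b ε ∪ Metric.ball d ε with hN
  have hNopen : IsOpen N := Metric.isOpen_ball.union Metric.isOpen_ball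
  have hbN : b ∈ N := Or.inl (Metric.mem_ball_self hε)
  have hdN : d ∈ N := Or.inr (Metric.mem_ball_self hε)
  have hNAB : ∀ z ∈ A ∪ B, z ∉ N := by
    rintro z hz (h | h)
    · exact hball₁ (Metric.ball_subset_ball hεε₁ h) hz
    · exact hball₂ (Metric.ball_subset_ball hεε₂ h) hz
  obtain ⟨δ₁, hδ₁, hf₁⟩ := Metric.continuous_iff.1 hf tb ε hε
  obtain ⟨δ₂, hδ₂, hf₂⟩ := Metric.continuous_iff.1 hf td ε hε
  obtain ⟨δ, hδ, hδδ₁, hδδ₂⟩ : ∃ δ > 0, δ < δ₁ ∧ δ < δ₂ :=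
    ⟨min δ₁ δ₂ / 2, by positivity, by have := min_le_left δ₁ δ₂; linarith,
      by have := min_le_right δ₁ δ₂; linarith⟩
  have hNb : ∀ x, tb - δ ≤ x → x ≤ tb + δ → f x ∈ N := fun x hx hx' =>
    Or.inl (hf₁ x (by rw [Real.dist_eq, abs_lt]; constructor <;> linarith))
  have hNd : ∀ x, td - δ ≤ x → x ≤ td + δ → f x ∈ N := fun x hx hx' =>
    Or.inr (hf₂ x (by rw [Real.dist_eq, abs_lt]; constructor <;> linarith))
  have hNd' : ∀ x, td - 1 - δ ≤ x → x ≤ td - 1 + δ → f x ∈ N := fun x hx hx' => by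
    rw [← hper x]
    exact hNd _ (by linarith) (by linarith)
  have hpN := hNAB _ (Or.inl hpA)
  have hqN := hNAB _ (Or.inl hqA)
  have htp1 : tp < tb - δ := by
    by_contra! h; exact hpN (hNb tp h (by linarith))
  have htp2 : td - 1 + δ < tp := by
    by_contra! h; exact hpN (hNd' tp (by linarith) h)
  have htq1 : tb + δ < tq := by
    by_contra! h; exact hqN (hNb tq (by linarith) h)
  have htq2 : tq < td - δ := by
    by_contra! h; exact hqN (hNd tq h (by linarith))
  set P := f '' Icc (td - 1 + δ) (tb - δ) with hP
  set Q := f '' Icc (tb + δ) (td - δ) with hQ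
  have hPc : IsClosed P := (isCompact_Icc.image hf).isClosed
  have hQc : IsClosed Q := (isCompact_Icc.image hf).isClosed
  have hPpre : IsPreconnected P := isPreconnected_Icc.image f hf.continuousOn
  have hQpre : IsPreconnected Q := isPreconnected_Icc.image f hf.continuousOn
  have hpP : f tp ∈ P := ⟨tp, ⟨by linarith, by linarith⟩, rfl⟩
  have hqQ : f tq ∈ Q := ⟨tq, ⟨by linarith, by linarith⟩, rfl⟩
  have hPQO : P ∪ Q ⊆ range f := union_subset (image_subset_range _ _) (image_subset_range _ _)
  have hOPQ : ∀ z ∈ range f, z ∉ N → z ∈ P ∪ Q := by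
    rintro _ ⟨x, rfl⟩ hxN
    obtain ⟨y, ⟨hy1, hy2⟩, hxy⟩ := hper.exists_mem_Ico one_pos x (td - 1)
    rw [hxy] at hxN ⊢
    have hy1' : td - 1 + δ < y := by
      by_contra! h; exact hxN (hNd' y (by linarith) h)
    have hy2' : y < td - δ := by
      by_contra! h; exact hxN (hNd y h (by linarith))
    rcases lt_or_ge y (tb - δ) with h | h
    · exact Or.inl ⟨y, ⟨hy1'.le, h.le⟩, rfl⟩
    · have : tb + δ < y := by
        by_contra! h'; exact hxN (hNb y h h')
      exact Or.inr ⟨y, ⟨this.le, hy2'.le⟩, rfl⟩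
  have hIoc : InjOn f (Ioc (td - 1) td) := injOn_of_periodic_of_injOn hper hinj
    (by rintro x ⟨hx, hx'⟩ y ⟨hy, hy'⟩; linarith)
  have hPQ_ne : ∀ y, y = tb ∨ y = td → f y ∉ P ∪ Q := by
    rintro y hy (⟨x, ⟨hx, hx'⟩, hxy⟩ | ⟨x, ⟨hx, hx'⟩, hxy⟩)
    all_goals
      have := hIoc ⟨by linarith, by linarith⟩
        ⟨by rcases hy with rfl | rfl <;> linarith, by rcases hy with rfl | rfl <;> linarith⟩ hxy
      rcases hy with rfl | rfl <;> linarith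
  have hbPQ : b ∉ P ∪ Q := hPQ_ne tb (Or.inl rfl)
  have hdPQ : d ∉ P ∪ Q := hPQ_ne td (Or.inr rfl)
  have hUVd : ∀ z ∈ range f, z ∉ U ∧ z ∉ V := fun z hz =>
    ⟨fun h => (hUV ▸ Or.inl h : z ∈ (range f)ᶜ) hz, fun h => (hUV ▸ Or.inr h : z ∈ (range f)ᶜ) hz⟩
  have hUV' : (range f)ᶜ = V ∪ U := by rw [hUV, union_comm]
  have hclU := closure_subset_union_of_isOpen hUV hdisj hV
  have hclV := closure_subset_union_of_isOpen hUV' hdisj.symm hU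
  -- a logarithm on the closure of one domain, away from `b` and `d`
  have key : ∀ X Y : Set ℂ, IsPreconnected Y → b ∈ closure Y → d ∈ closure Y →
      (∀ z ∈ range f, z ∉ Y) → (∀ z ∈ closure X, z ∉ Y) →
      ∃ g : ℂ → ℂ, ContinuousOn g (closure X \ N ∪ (P ∪ Q)) ∧
        ∀ z ∈ closure X \ N ∪ (P ∪ Q), Complex.exp (g z) = (z - b) / (z - d) := by
    intro X Y hY hbY hdY hYO hXY
    refine exists_log_of_isPreconnected (K := insert b (insert d Y))
      ((isClosed_closure.sdiff hNopen).union (hPc.union hQc))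
      (hY.subset_closure (fun z hz => Or.inr (Or.inr hz))
        (insert_subset hbY (insert_subset hdY subset_closure))) ?_ (Or.inl rfl)
      (Or.inr (Or.inl rfl))
    rintro z (rfl | rfl | hz) (⟨h, h'⟩ | h)
    · exact h' hbN
    · exact hbPQ h
    · exact h' hdN
    · exact hdPQ h
    · exact hXY z h hz
    · exact hYO z (hPQO h) hz
  obtain ⟨gU, hgU, hgUe⟩ := key U V hVc.isPreconnected (hbV tb) (hbV td)
    (fun z hz => (hUVd z hz).2)
    (fun z hz h => (hclU hz).elim (fun h' => hdisj.ne_of_mem h' h rfl) fun h' => (hUVd z h').2 h)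
  obtain ⟨gV, hgV, hgVe⟩ := key V U hUc.isPreconnected (hbU tb) (hbU td)
    (fun z hz => (hUVd z hz).1)
    (fun z hz h => (hclV hz).elim (fun h' => hdisj.ne_of_mem h h' rfl) fun h' => (hUVd z h').1 h)
  obtain ⟨g, hg, hge⟩ := exists_log_of_isPreconnected (hAc.union hBc) hK hKAB hbK hdK
  set KU := closure U \ N ∪ (P ∪ Q) with hKU
  set KV := closure V \ N ∪ (P ∪ Q) with hKV
  have hAK : A ⊆ KU := fun z hz => Or.inl ⟨hAU hz, hNAB z (Or.inl hz)⟩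
  have hBK : B ⊆ KV := fun z hz => Or.inl ⟨hBV hz, hNAB z (Or.inr hz)⟩
  have hPU : P ⊆ KU := fun z hz => Or.inr (Or.inl hz)
  have hQU : Q ⊆ KU := fun z hz => Or.inr (Or.inr hz)
  have hPV : P ⊆ KV := fun z hz => Or.inr (Or.inl hz)
  have hQV : Q ⊆ KV := fun z hz => Or.inr (Or.inr hz)
  obtain ⟨kA, -, hkA⟩ := exists_eq_add_of_exp_eq hA (hg.mono subset_union_left) (hgU.mono hAK)
    fun z hz => by rw [hge z (Or.inl hz), hgUe z (hAK hz)]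
  obtain ⟨kB, -, hkB⟩ := exists_eq_add_of_exp_eq hB (hg.mono subset_union_right) (hgV.mono hBK)
    fun z hz => by rw [hge z (Or.inr hz), hgVe z (hBK hz)]
  obtain ⟨kP, hkP1, hkP⟩ := exists_eq_add_of_exp_eq hPpre (hgU.mono hPU) (hgV.mono hPV)
    fun z hz => by rw [hgUe z (hPU hz), hgVe z (hPV hz)]
  obtain ⟨kQ, -, hkQ⟩ := exists_eq_add_of_exp_eq hQpre (hgU.mono hQU) (hgV.mono hQV)
    fun z hz => by rw [hgUe z (hQU hz), hgVe z (hQV hz)]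
  have hPQ : kP = kQ := by
    linear_combination hkQ _ hqQ - hkP _ hpP + hkA _ hqA - hkB _ hqB - hkA _ hpA + hkB _ hpB
  subst hPQ
  have hagree : ∀ z ∈ P ∪ Q, gU z = gV z + kP := fun z hz => hz.elim (hkP z) (hkQ z)
  classical
  set L : ℂ → ℂ := fun z => if z ∈ KU then gU z else gV z + kP with hL
  have hLU : EqOn L gU KU := fun z hz => if_pos hz
  have hLV : EqOn L (fun z => gV z + kP) KV := by
    intro z hz
    by_cases hzU : z ∈ KU
    · rw [hLU hzU]
      apply hagree
      by_contra hcon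
      obtain ⟨hz1, hzN⟩ := hz.resolve_right hcon
      obtain ⟨hz2, -⟩ := hzU.resolve_right hcon
      refine hcon (hOPQ z ?_ hzN)
      by_contra hzO
      exact hdisj.ne_of_mem ((hclU hz2).resolve_right hzO) ((hclV hz1).resolve_right hzO) rfl
    · exact if_neg hzU
  have hKUc : IsClosed KU := (isClosed_closure.sdiff hNopen).union (hPc.union hQc)
  have hKVc : IsClosed KV := (isClosed_closure.sdiff hNopen).union (hPc.union hQc)
  have hLc : ContinuousOn L (KU ∪ KV) := (hgU.congr hLU).union_of_isClosed
    ((hgV.add continuousOn_const).congr hLV) hKUc hKVc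
  have hLe : ∀ z ∈ KU ∪ KV, Complex.exp (L z) = (z - b) / (z - d) := by
    rintro z (hz | hz)
    · rw [hLU hz, hgUe z hz]
    · rw [hLV hz]
      simp only
      rw [Complex.exp_add, hkP1, mul_one, hgVe z hz]
  have hsphere : Metric.sphere b ε ⊆ KU ∪ KV := by
    intro z hz
    rw [Metric.mem_sphere] at hz
    have hzN : z ∉ N := by
      rintro (h | h)
      · rw [Metric.mem_ball, hz] at h
        exact lt_irrefl _ h
      · rw [Metric.mem_ball] at h
        have := dist_triangle_left b d z
        linarith
    by_cases hzO : z ∈ range f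
    · exact Or.inl (Or.inr (hOPQ z hzO hzN))
    · have : z ∈ U ∪ V := hUV ▸ hzO
      exact this.imp (fun h => Or.inl ⟨subset_closure h, hzN⟩)
        (fun h => Or.inl ⟨subset_closure h, hzN⟩)
  have hbd' : b - d ≠ 0 := sub_ne_zero.2 hbd
  have hslit : ∀ z ∈ Metric.sphere b ε, 1 + (z - b) / (b - d) ∈ Complex.slitPlane := by
    intro z hz
    rw [mem_sphere_iff_norm] at hz
    rw [dist_eq_norm] at hεd
    apply Complex.mem_slitPlane_of_norm_lt_one
    rw [norm_div, hz, div_lt_one (by linarith)]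
    linarith
  refine not_exp_eq_mul_sub_on_sphere (b := b) (c := (b - d)⁻¹) hε.le
    (g := fun z => L z + Complex.log (1 + (z - b) / (b - d)))
    ((hLc.mono hsphere).add (ContinuousOn.clog (by fun_prop) hslit)) fun z hz => ?_
  have hzd : z - d ≠ 0 := fun h => by
    apply Complex.slitPlane_ne_zero (hslit z hz)
    rw [sub_eq_zero.1 h]
    field_simp
    ring
  rw [Complex.exp_add, hLe z (hsphere hz), Complex.exp_log (Complex.slitPlane_ne_zero (hslit z hz))]
  field_simp
  ring

/-- Two arcs that meet only in their common endpoints form a simple closed curve. -/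
theorem isSimpleClosedCurve_union_of_arcs {α β : ℝ → Plane} (hα : Continuous α)
    (hβ : Continuous β) {s t s' t' : ℝ} (hst : s < t) (hst' : s' ≠ t') (hαi : InjOn α (Icc s t))
    (hβi : InjOn β (uIcc t' s')) (hs : α s = β s') (ht : α t = β t')
    (hmeet : ∀ x ∈ Ioo s t, α x ∉ β '' uIcc t' s') :
    IsSimpleClosedCurve (α '' Icc s t ∪ β '' uIcc t' s') := by
  have hst0 : 0 < t - s := sub_pos.2 hst
  set γ : ℝ → Plane := fun x =>
    if x ≤ 1 / 2 then α (s + 2 * x * (t - s)) else β (t' + (2 * x - 1) * (s' - t')) with hγ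
  have hγ₁ : ∀ x, x ≤ 1 / 2 → γ x = α (s + 2 * x * (t - s)) := fun x hx => if_pos hx
  have hγ₂ : ∀ x, 1 / 2 < x → γ x = β (t' + (2 * x - 1) * (s' - t')) :=
    fun x hx => if_neg (not_le.2 hx)
  have hγc : Continuous γ := by
    refine Continuous.if_le (by fun_prop) (by fun_prop) continuous_id continuous_const ?_
    rintro x rfl
    convert ht using 2 <;> ring
  have hseg : uIcc t' s' = (fun θ => t' + θ * (s' - t')) '' Icc 0 1 := by
    rw [← segment_eq_uIcc, segment_eq_image']
    rfl
  have hmem₁ : ∀ x, 0 ≤ x → x ≤ 1 / 2 → s + 2 * x * (t - s) ∈ Icc s t := fun x h0 h1 =>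
    ⟨by nlinarith, by nlinarith⟩
  have hmem₂ : ∀ x, 1 / 2 < x → x ≤ 1 → t' + (2 * x - 1) * (s' - t') ∈ uIcc t' s' :=
    fun x h0 h1 => by
      rw [hseg]
      exact ⟨2 * x - 1, ⟨by linarith, by linarith⟩, rfl⟩
  have hcross : ∀ x y, 0 ≤ x → x ≤ 1 / 2 → 1 / 2 < y → y < 1 → γ x ≠ γ y := by
    intro x y hx0 hx1 hy0 hy1 h
    rw [hγ₁ x hx1, hγ₂ y hy0] at h
    have hv := hmem₂ y hy0 hy1.le
    have hd : s' - t' ≠ 0 := sub_ne_zero.2 hst'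
    rcases eq_or_lt_of_le hx0 with rfl | hx0
    · simp only [mul_zero, zero_mul, add_zero] at h
      rw [hs] at h
      have h' := hβi right_mem_uIcc hv h
      have : (2 - 2 * y) * (s' - t') = 0 := by linear_combination h'
      rcases mul_eq_zero.1 this with h | h
      · linarith
      · exact hd h
    · rcases eq_or_lt_of_le hx1 with rfl | hx1
      · rw [show s + 2 * (1 / 2) * (t - s) = t by ring, ht] at h
        have h' := hβi left_mem_uIcc hv h
        have : (2 * y - 1) * (s' - t') = 0 := by linear_combination -h'
        rcases mul_eq_zero.1 this with h | h
        · linarith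
        · exact hd h
      · exact hmeet _ ⟨by nlinarith, by nlinarith⟩ ⟨_, hv, h.symm⟩
  have hγinj : InjOn γ (Ico 0 1) := by
    rintro x ⟨hx0, hx1⟩ y ⟨hy0, hy1⟩ h
    rcases le_or_gt x (1 / 2) with hx | hx <;> rcases le_or_gt y (1 / 2) with hy | hy
    · rw [hγ₁ x hx, hγ₁ y hy] at h
      have h' := hαi (hmem₁ x hx0 hx) (hmem₁ y hy0 hy) h
      have : (x - y) * (t - s) = 0 := by linear_combination h' / 2
      exact sub_eq_zero.1 ((mul_eq_zero.1 this).resolve_right hst0.ne')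
    · exact absurd h (hcross x y hx0 hx hy hy1)
    · exact absurd h.symm (hcross y x hy0 hy hx hx1)
    · rw [hγ₂ x hx, hγ₂ y hy] at h
      have h' := hβi (hmem₂ x hx hx1.le) (hmem₂ y hy hy1.le) h
      have : (x - y) * (s' - t') = 0 := by linear_combination h' / 2
      exact sub_eq_zero.1 ((mul_eq_zero.1 this).resolve_right (sub_ne_zero.2 hst'))
  have hγ01 : γ 0 = γ 1 := by
    rw [hγ₁ 0 (by norm_num), hγ₂ 1 (by norm_num)]
    convert hs using 2 <;> ring
  have hfr : EqOn (γ ∘ Int.fract) γ (Ico 0 1) := fun x hx => by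
    rw [Function.comp_apply, Int.fract_eq_self.2 hx]
  refine ⟨γ ∘ Int.fract, hγc.continuousOn.comp_fract'' hγ01, fun x => by simp,
    hγinj.congr hfr.symm, ?_⟩
  rw [hfr.image_eq]
  apply subset_antisymm
  · rintro _ ⟨x, ⟨hx0, hx1⟩, rfl⟩
    rcases le_or_gt x (1 / 2) with hx | hx
    · rw [hγ₁ x hx]
      exact Or.inl (mem_image_of_mem _ (hmem₁ x hx0 hx))
    · rw [hγ₂ x hx]
      exact Or.inr (mem_image_of_mem _ (hmem₂ x hx hx1.le))
  · have hA : α '' Icc s t ⊆ γ '' Ico 0 1 := by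
      rintro _ ⟨u, ⟨hu, hu'⟩, rfl⟩
      have hle : (u - s) / (t - s) ≤ 1 := (div_le_one hst0).2 (by linarith)
      refine ⟨(u - s) / (t - s) / 2, ⟨div_nonneg (div_nonneg (by linarith) hst0.le) (by norm_num),
        by linarith⟩, ?_⟩
      rw [hγ₁ _ (by linarith)]
      congr 1
      field_simp
      ring
    refine union_subset hA ?_
    rintro _ ⟨v, hv, rfl⟩
    rw [hseg] at hv
    obtain ⟨θ, ⟨hθ0, hθ1⟩, rfl⟩ := hv
    rcases eq_or_lt_of_le hθ0 with rfl | hθ0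
    · simp only [zero_mul, add_zero, ← ht]
      exact hA ⟨t, right_mem_Icc.2 hst.le, rfl⟩
    · rcases eq_or_lt_of_le hθ1 with rfl | hθ1
      · simp only [one_mul, add_sub_cancel, ← hs]
        exact hA ⟨s, left_mem_Icc.2 hst.le, rfl⟩
      · refine ⟨(1 + θ) / 2, ⟨by linarith, by linarith⟩, ?_⟩
        rw [hγ₂ _ (by linarith)]
        congr 1
        ring

/-- If a path leads from a closed set `P` to a closed set `Q`, and meets `B` only in `P ∪ Q`,
then it has a subpath from `P ∩ B` to `Q ∩ B` whose interior misses `B`. -/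
theorem exists_subpath_avoiding {X : Type*} [TopologicalSpace X] {α : ℝ → X}
    (hα : Continuous α) {B P Q : Set X} (hP : IsClosed (B ∩ P)) (hQ : IsClosed (B ∩ Q))
    (hPQ : B ∩ P ∩ Q = ∅) (hsub : ∀ x ∈ Icc (0 : ℝ) 1, α x ∈ B → α x ∈ P ∪ Q)
    (h0 : α 0 ∈ B ∩ P) (h1 : α 1 ∈ B ∩ Q) :
    ∃ s t, 0 ≤ s ∧ s < t ∧ t ≤ 1 ∧ α s ∈ B ∩ P ∧ α t ∈ B ∩ Q ∧ ∀ x ∈ Ioo s t, α x ∉ B := by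
  obtain ⟨s, ⟨⟨hs0, hs1⟩, hsP⟩, hs⟩ := (isCompact_Icc.inter_right (hP.preimage hα)
    : IsCompact (Icc (0 : ℝ) 1 ∩ α ⁻¹' (B ∩ P))).exists_isGreatest ⟨0, ⟨le_rfl, zero_le_one⟩, h0⟩
  obtain ⟨t, ⟨⟨hst, ht1⟩, htQ⟩, ht⟩ := (isCompact_Icc.inter_right (hQ.preimage hα)
    : IsCompact (Icc s 1 ∩ α ⁻¹' (B ∩ Q))).exists_isLeast ⟨1, ⟨hs1, le_rfl⟩, h1⟩
  have hne : s ≠ t := by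
    rintro rfl
    exact (hPQ ▸ ⟨hsP, htQ.2⟩ : α s ∈ (∅ : Set X))
  refine ⟨s, t, hs0, lt_of_le_of_ne hst hne, ht1, hsP, htQ, fun x hx hxB => ?_⟩
  rcases hsub x ⟨by linarith [hx.1], by linarith [hx.2]⟩ hxB with h | h
  · exact absurd (hs ⟨⟨by linarith [hx.1], by linarith [hx.2]⟩, hxB, h⟩) (not_le.2 hx.1)
  · exact absurd (ht ⟨⟨hx.1.le, by linarith [hx.2]⟩, hxB, h⟩) (not_le.2 hx.2)

theorem IsArcWithEndpoints.exists_continuous {X : Type*} [TopologicalSpace X] {A : Set X}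
    {a c : X} (h : IsArcWithEndpoints A a c) : ∃ α : ℝ → X, Continuous α ∧
      InjOn α (Icc 0 1) ∧ α '' Icc 0 1 = A ∧ α 0 = a ∧ α 1 = c := by
  obtain ⟨α, hα, hi, him, h0, h1⟩ := h
  have he : EqOn (IccExtend zero_le_one ((Icc (0 : ℝ) 1).domRestrict α)) α (Icc 0 1) :=
    fun x hx => IccExtend_of_mem zero_le_one _ hx
  refine ⟨IccExtend zero_le_one ((Icc (0 : ℝ) 1).domRestrict α), hα.domRestrict.Icc_extend',
    hi.congr he.symm, by rw [he.image_eq, him], ?_, ?_⟩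
  · rw [he (left_mem_Icc.2 zero_le_one), h0]
  · rw [he (right_mem_Icc.2 zero_le_one), h1]

/-- Proposition 8, θ-curve consequence. -/
theorem stmt_10 (O U V : Set Plane) (f : ℝ → Plane)
    (hf : Continuous f) (hper : Function.Periodic f 1)
    (hinj : Set.InjOn f (Set.Ico 0 1)) (hrange : f '' Set.Ico 0 1 = O)
    (hUV : Oᶜ = U ∪ V) (hdisj : Disjoint U V)
    (hUopen : IsOpen U) (hUconn : IsConnected U) (hUbd : Bornology.IsBounded U)
    (hVopen : IsOpen V) (hVconn : IsConnected V) (hVubd : ¬ Bornology.IsBounded V)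
    (a b c d : Plane) (ta tb tc td : ℝ)
    (h0 : 0 ≤ ta) (h1 : ta < tb) (h2 : tb < tc) (h3 : tc < td) (h4 : td < 1)
    (hfa : f ta = a) (hfb : f tb = b) (hfc : f tc = c) (hfd : f td = d)
    (A B : Set Plane)
    (hA : IsArcWithEndpoints A a c) (hAsub : A ⊆ closure U \ {b, d})
    (hB : IsArcWithEndpoints B a c) (hBsub : B ⊆ closure V \ {b, d}) :
    ∃ σ : Set Plane, σ ⊆ A ∪ B ∧ IsSimpleClosedCurve σ ∧ SeparatesPoints σ b d := by
  obtain ⟨α, hα, hαi, hαA, hα0, hα1⟩ := hA.exists_continuous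
  obtain ⟨β, hβ, hβi, hβB, hβ0, hβ1⟩ := hB.exists_continuous
  have hO : range f = O := by
    rw [← hrange]
    refine subset_antisymm ?_ (image_subset_range _ _)
    rintro _ ⟨x, rfl⟩
    obtain ⟨y, hy, hxy⟩ := hper.exists_mem_Ico₀ one_pos x
    exact ⟨y, hy, hxy.symm⟩
  have hUV' : Oᶜ = V ∪ U := by rw [hUV, union_comm]
  have hbA : b ∉ A := fun h => (hAsub h).2 (Or.inl rfl)
  have hdA : d ∉ A := fun h => (hAsub h).2 (Or.inr rfl)
  have hbB : b ∉ B := fun h => (hBsub h).2 (Or.inl rfl)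
  have hdB : d ∉ B := fun h => (hBsub h).2 (Or.inr rfl)
  have hBc : IsClosed B := hβB ▸ (isCompact_Icc.image hβ).isClosed
  set P := f '' Icc (td - 1) tb with hP
  set Q := f '' Icc tb td with hQ
  have hfd' : f (td - 1) = d := by rw [hper.sub_eq, hfd]
  have hopenP : ∀ z ∈ B ∩ P, ∃ x, td - 1 < x ∧ x < tb ∧ f x = z := by
    rintro _ ⟨hz, x, ⟨hx, hx'⟩, rfl⟩
    refine ⟨x, lt_of_le_of_ne hx ?_, lt_of_le_of_ne hx' ?_, rfl⟩
    · rintro rfl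
      exact hdB (hfd' ▸ hz)
    · rintro rfl
      exact hbB (hfb ▸ hz)
  have hopenQ : ∀ z ∈ B ∩ Q, ∃ x, tb < x ∧ x < td ∧ f x = z := by
    rintro _ ⟨hz, x, ⟨hx, hx'⟩, rfl⟩
    refine ⟨x, lt_of_le_of_ne hx ?_, lt_of_le_of_ne hx' ?_, rfl⟩
    · rintro rfl
      exact hbB (hfb ▸ hz)
    · rintro rfl
      exact hdB (hfd ▸ hz)
  have hPQ : B ∩ P ∩ Q = ∅ := by
    rw [eq_empty_iff_forall_notMem]
    rintro z ⟨hzP, hzQ⟩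
    obtain ⟨x, hx1, hx2, rfl⟩ := hopenP z hzP
    obtain ⟨y, hy1, hy2, hxy⟩ := hopenQ _ ⟨hzP.1, hzQ⟩
    have := injOn_of_periodic_of_injOn hper hinj (S := Ioo (td - 1) td)
      (by rintro x ⟨hx, hx'⟩ y ⟨hy, hy'⟩; linarith) ⟨by linarith, hy2⟩ ⟨hx1, by linarith⟩ hxy
    linarith
  have hOPQ : O ⊆ P ∪ Q := by
    rw [← hO]
    rintro _ ⟨x, rfl⟩
    obtain ⟨y, ⟨hy1, hy2⟩, hxy⟩ := hper.exists_mem_Ico one_pos x (td - 1)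
    rw [hxy]
    rcases le_total y tb with h | h
    · exact Or.inl ⟨y, ⟨hy1, h⟩, rfl⟩
    · exact Or.inr ⟨y, ⟨h, by linarith⟩, rfl⟩
  have hmeet : ∀ x ∈ Icc (0 : ℝ) 1, α x ∈ B → α x ∈ P ∪ Q := by
    intro x hx hxB
    have hxA : α x ∈ A := hαA ▸ mem_image_of_mem α hx
    apply hOPQ
    by_contra hcon
    exact hdisj.ne_of_mem
      ((closure_subset_union_of_isOpen hUV hdisj hVopen (hAsub hxA).1).resolve_right hcon)
      ((closure_subset_union_of_isOpen hUV' hdisj.symm hUopen (hBsub hxB).1).resolve_right hcon) rfl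
  have haB : a ∈ B := hβB ▸ ⟨0, left_mem_Icc.2 zero_le_one, hβ0⟩
  have hcB : c ∈ B := hβB ▸ ⟨1, right_mem_Icc.2 zero_le_one, hβ1⟩
  obtain ⟨s, t, hs0, hst, ht1, hs, ht, hav⟩ := exists_subpath_avoiding hα
    (hBc.inter (isCompact_Icc.image hf).isClosed) (hBc.inter (isCompact_Icc.image hf).isClosed) hPQ
    hmeet (hα0 ▸ ⟨haB, ta, ⟨by linarith, h1.le⟩, hfa⟩) (hα1 ▸ ⟨hcB, tc, ⟨h2.le, h3.le⟩, hfc⟩)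
  obtain ⟨tp, htp1, htp2, htp⟩ := hopenP _ hs
  obtain ⟨tq, htq1, htq2, htq⟩ := hopenQ _ ht
  obtain ⟨s', hs'I, hs'⟩ := hβB.symm ▸ hs.1
  obtain ⟨t', ht'I, ht'⟩ := hβB.symm ▸ ht.1
  have hsI : s ∈ Icc (0 : ℝ) 1 := ⟨hs0, by linarith⟩
  have htI : t ∈ Icc (0 : ℝ) 1 := ⟨by linarith, ht1⟩
  have hne : s' ≠ t' := by
    rintro rfl
    exact hst.ne (hαi hsI htI (hs'.symm.trans ht'))
  have hsub₁ : Icc s t ⊆ Icc (0 : ℝ) 1 := Icc_subset_Icc hs0 ht1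
  have hsub₂ : uIcc t' s' ⊆ Icc (0 : ℝ) 1 := uIcc_subset_Icc ht'I hs'I
  have hA'A : α '' Icc s t ⊆ A := hαA ▸ image_mono hsub₁
  have hB'B : β '' uIcc t' s' ⊆ B := hβB ▸ image_mono hsub₂
  refine ⟨α '' Icc s t ∪ β '' uIcc t' s', union_subset_union hA'A hB'B,
    isSimpleClosedCurve_union_of_arcs hα hβ hst hne (hαi.mono hsub₁) (hβi.mono hsub₂) hs'.symm
      ht'.symm fun x hx h => hav x hx (hB'B h),
    fun h => h.elim (fun h => hbA (hA'A h)) fun h => hbB (hB'B h),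
    fun h => h.elim (fun h => hdA (hA'A h)) fun h => hdB (hB'B h),
    fun K hKσ hK hbK hdK => ?_⟩
  let φ : Plane ≃ₜ ℂ := Complex.orthonormalBasisOneI.repr.symm.toHomeomorph
  have hφb : ∀ S : Set Plane, Bornology.IsBounded S → Bornology.IsBounded (φ '' S) := fun S hS =>
    Complex.orthonormalBasisOneI.repr.symm.lipschitz.isBounded_image hS
  have hφ : ∀ (S T : Set Plane), S ⊆ closure T → φ '' S ⊆ closure (φ '' T) := fun S T h => by
    rw [← φ.image_closure]
    exact image_mono h
  refine separation_of_crosscuts (f := φ ∘ f) (U := φ '' U) (V := φ '' V)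
    (A := φ '' (α '' Icc s t)) (B := φ '' (β '' uIcc t' s')) (K := φ '' K) (tb := tb) (td := td)
    (tp := tp) (tq := tq)
    (φ.continuous.comp hf) (hper.comp φ) (φ.injective.comp_injOn hinj) ?_
    ((disjoint_image_iff φ.injective).2 hdisj) (φ.isOpenMap _ hUopen) (φ.isOpenMap _ hVopen)
    (hUconn.image _ φ.continuous.continuousOn) (hVconn.image _ φ.continuous.continuousOn)
    (hφb U hUbd) htp1 htp2 htq1 htq2
    ((isPreconnected_Icc.image _ hα.continuousOn).image _ φ.continuous.continuousOn)
    ((isPreconnected_uIcc.image _ hβ.continuousOn).image _ φ.continuous.continuousOn)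
    (φ.isClosedMap _ (isCompact_Icc.image hα).isClosed)
    (φ.isClosedMap _ (isCompact_uIcc.image hβ).isClosed)
    (hφ _ _ fun z hz => (hAsub (hA'A hz)).1) (hφ _ _ fun z hz => (hBsub (hB'B hz)).1)
    ?_ ?_ ?_ ?_ (hK.image _ φ.continuous.continuousOn) ?_
    (mem_image_of_mem φ (hfb ▸ hbK)) (mem_image_of_mem φ (hfd ▸ hdK))
  · rw [range_comp, ← image_compl_eq φ.bijective, hO, hUV, image_union]
  · exact mem_image_of_mem φ ⟨s, left_mem_Icc.2 hst.le, htp.symm⟩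
  · exact mem_image_of_mem φ ⟨t, right_mem_Icc.2 hst.le, htq.symm⟩
  · exact mem_image_of_mem φ ⟨s', right_mem_uIcc, hs'.trans htp.symm⟩
  · exact mem_image_of_mem φ ⟨t', left_mem_uIcc, ht'.trans htq.symm⟩
  · rw [← image_union, ← image_compl_eq φ.bijective]
    exact image_mono hKσ
end
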